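/- Optimal 1D collapsing estimate (positive part, Theorem 1.3): For every T > 0, every ε > 0, and every k ≥ 1 there is a constant C (depending only on T and ε, in particular independent of k and j) such that for every j with 1 ≤ j ≤ k and every Schwartz function φ on ℝ^{k+1} × ℝ^{k+1}, one has ( ∫_0^T ‖ R_ε^{(k)} B_{j,k+1} U^{(k+1)}(τ) φ ‖_{L²(ℝ^k×ℝ^k)}² dτ )^{1/2} ≤ C ‖ R_ε^{(k+1)} φ ‖_{L²(ℝ^{k+1}×ℝ^{k+1})}. -/

import Mathlib

open MeasureTheory Complex
open scoped ENNReal NNReal BigOperators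

noncomputable section

/-- Euclidean dot product on `Fin k → ℝ`. -/
def dotR {k : ℕ} (a b : Fin k → ℝ) : ℝ := ∑ i, a i * b i

/-- Japanese bracket `⟨x⟩ = √(1+x²)`. -/
def jap (x : ℝ) : ℝ := Real.sqrt (1 + x ^ 2)

/-- Fourier transform with the convention
`φ̂(ξ,ξ') = ∫ e^{-i(y·ξ + y'·ξ')} φ(y,y') dy dy'`. -/
def ftK (k : ℕ) (φ : (Fin k → ℝ) × (Fin k → ℝ) → ℂ) :
    (Fin k → ℝ) × (Fin k → ℝ) → ℂ :=
  fun ξ => ∫ y : (Fin k → ℝ) × (Fin k → ℝ),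
    Complex.exp (-Complex.I * ((dotR y.1 ξ.1 + dotR y.2 ξ.2 : ℝ) : ℂ)) * φ y

/-- Free evolution `U^{(k)}(τ)`, defined via Fourier inversion: it is the function whose
Fourier transform is `e^{-iτ(|ξ|² - |ξ'|²)} φ̂(ξ,ξ')`. -/
def freeEvol (k : ℕ) (τ : ℝ) (φ : (Fin k → ℝ) × (Fin k → ℝ) → ℂ) :
    (Fin k → ℝ) × (Fin k → ℝ) → ℂ :=
  fun y => (((2 * Real.pi) ^ (2 * k))⁻¹ : ℝ) •
    ∫ ξ : (Fin k → ℝ) × (Fin k → ℝ),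
      Complex.exp (Complex.I * ((dotR y.1 ξ.1 + dotR y.2 ξ.2
        - τ * ((∑ i, ξ.1 i ^ 2) - (∑ i, ξ.2 i ^ 2)) : ℝ) : ℂ)) * ftK k φ ξ

/-- The Fourier multiplier `R_ε^{(k)}` with symbol `∏_j ⟨ξ_j⟩^ε ⟨ξ'_j⟩^ε`. -/
def Rop (ε : ℝ) (k : ℕ) (f : (Fin k → ℝ) × (Fin k → ℝ) → ℂ) :
    (Fin k → ℝ) × (Fin k → ℝ) → ℂ :=
  fun y => (((2 * Real.pi) ^ (2 * k))⁻¹ : ℝ) •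
    ∫ ξ : (Fin k → ℝ) × (Fin k → ℝ),
      Complex.exp (Complex.I * ((dotR y.1 ξ.1 + dotR y.2 ξ.2 : ℝ) : ℂ)) *
        (((∏ j, jap (ξ.1 j) ^ ε * jap (ξ.2 j) ^ ε : ℝ) : ℂ) * ftK k f ξ)

/-- The collision operator `B_{j,k+1}`. -/
def collision (k : ℕ) (j : Fin k) (u : (Fin (k+1) → ℝ) × (Fin (k+1) → ℝ) → ℂ) :
    (Fin k → ℝ) × (Fin k → ℝ) → ℂ :=
  fun y => u (Fin.snoc y.1 (y.1 j), Fin.snoc y.2 (y.1 j))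
         - u (Fin.snoc y.1 (y.2 j), Fin.snoc y.2 (y.2 j))

/-- The `L²` norm, valued in `[0,∞]`. -/
def L2E (k : ℕ) (f : (Fin k → ℝ) × (Fin k → ℝ) → ℂ) : ℝ≥0∞ :=
  (∫⁻ y : (Fin k → ℝ) × (Fin k → ℝ), (‖f y‖₊ : ℝ≥0∞) ^ 2) ^ (1/2 : ℝ)

lemma lintegral_comp_mul_add (f : ℝ → ℝ≥0∞) {a : ℝ} (ha : 0 < a) (b : ℝ) :
    ∫⁻ x, f (a * x + b) = ENNReal.ofReal a⁻¹ * ∫⁻ x, f x := by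
  rw [← lintegral_add_right_eq_self f b]
  have h := Real.map_volume_mul_left ha.ne'
  have e : MeasurableEmbedding (fun x : ℝ => a * x) :=
    (Homeomorph.mulLeft₀ a ha.ne').measurableEmbedding
  have := e.lintegral_map (μ := volume) (fun x => f (x + b))
  rw [← this, h, lintegral_smul_measure, abs_of_pos (inv_pos.2 ha)]
  rfl

lemma lintegral_inv_one_add_sq :
    ∫⁻ x : ℝ, ENNReal.ofReal (1 + x ^ 2)⁻¹ = ENNReal.ofReal Real.pi := by
  rw [← integral_univ_inv_one_add_sq, ofReal_integral_eq_lintegral_ofReal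
    integrable_inv_one_add_sq (Filter.Eventually.of_forall fun x => by positivity)]

lemma one_le_jap (x : ℝ) : 1 ≤ jap x := by
  rw [jap, Real.one_le_sqrt]; nlinarith [sq_nonneg x]

lemma jap_pos (x : ℝ) : 0 < jap x := one_pos.trans_le (one_le_jap x)

lemma jap_sq (x : ℝ) : jap x ^ 2 = 1 + x ^ 2 := Real.sq_sqrt (by positivity)

lemma continuous_jap : Continuous jap := by unfold jap; fun_prop

lemma jap_rpow_eq (x r : ℝ) : jap x ^ r = (1 + ‖x‖ ^ 2) ^ (r / 2) := by
  rw [jap, Real.sqrt_eq_rpow, ← Real.rpow_mul (by positivity), Real.norm_eq_abs, sq_abs]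
  congr 1; ring

lemma continuous_jap_rpow (r : ℝ) : Continuous fun x => jap x ^ r :=
  continuous_jap.rpow_const fun x => Or.inl (jap_pos x).ne'

lemma jap_add_add_le (a b c : ℝ) : jap (a + b + c) ≤ jap a + jap b + jap c := by
  have h (x y : ℝ) : jap (x + y) ≤ jap x + jap y := by
    have h1 := one_le_jap x
    have h2 := one_le_jap y
    have hx : |x| ≤ jap x := Real.le_sqrt_of_sq_le (by rw [sq_abs]; linarith)
    have hy : |y| ≤ jap y := Real.le_sqrt_of_sq_le (by rw [sq_abs]; linarith)
    have hxy : x * y ≤ jap x * jap y := (le_abs_self _).trans (by rw [abs_mul]; gcongr)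
    refine (Real.sqrt_le_left (by linarith)).2 ?_
    nlinarith [jap_sq x, jap_sq y]
  exact (h _ _).trans (by gcongr; exact h a b)

lemma jap_sub_le (a b : ℝ) : jap (a - b) ≤ 2 * (jap a * jap b) := by
  have h1 := jap_pos a
  have h2 := jap_pos b
  refine (Real.sqrt_le_left (by positivity)).2 ?_
  rw [mul_pow, mul_pow, jap_sq, jap_sq]
  nlinarith [sq_nonneg (a + b), mul_nonneg (sq_nonneg a) (sq_nonneg b)]

lemma lintegral_jap_rpow_lt_top {r : ℝ} (hr : 1 < r) :
    ∫⁻ x : ℝ, ENNReal.ofReal (jap x ^ (-r)) < ⊤ := by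
  have h := integrable_rpow_neg_one_add_norm_sq (E := ℝ) (μ := volume) (r := r) (by simpa using hr)
  refine lt_of_le_of_lt (lintegral_mono fun x => ?_) h.lintegral_lt_top
  rw [jap_rpow_eq]

/-- Pointwise lower bound used to integrate a Cauchy kernel along `v ↦ v ^ 2 - B`. -/
lemma one_add_sq_sub_ge (v B : ℝ) :
    (1 + (1 + |B|) * (|v| - √|B|) ^ 2) / 2 ≤ 1 + (v ^ 2 - B) ^ 2 := by
  obtain ⟨a, ha, hB⟩ : ∃ a, 0 ≤ a ∧ √|B| = a := ⟨_, Real.sqrt_nonneg _, rfl⟩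
  have hB2 : |B| = a ^ 2 := by rw [← hB, Real.sq_sqrt (abs_nonneg _)]
  rw [hB, hB2]
  obtain ⟨w, hw, hvw⟩ : ∃ w, 0 ≤ w ∧ |v| = w := ⟨_, abs_nonneg _, rfl⟩
  have hv2 : v ^ 2 = w ^ 2 := by rw [← hvw, sq_abs]
  rw [hvw, hv2]
  have key : (w ^ 2 - a ^ 2) ^ 2 ≤ (w ^ 2 - B) ^ 2 := by
    rcases abs_cases B with ⟨h, _⟩ | ⟨h, _⟩
    · rw [← hB2, h]
    · have : B = -a ^ 2 := by linarith
      rw [this]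
      nlinarith [mul_nonneg (sq_nonneg a) (sq_nonneg w)]
  have k2 : (w ^ 2 - a ^ 2) ^ 2 = (w - a) ^ 2 * (w + a) ^ 2 := by ring
  have h4 : (w - a) ^ 2 ≤ (w + a) ^ 2 := by nlinarith [mul_nonneg hw ha]
  have h5 : a ^ 2 ≤ (w + a) ^ 2 := by nlinarith [mul_nonneg hw ha]
  have h6 := mul_le_mul_of_nonneg_left h4 (sq_nonneg (w - a))
  have h7 := mul_le_mul_of_nonneg_left h5 (sq_nonneg (w - a))
  nlinarith [sq_nonneg ((w - a) ^ 2 - 1)]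

lemma lintegral_cauchy_sq_sub_le (B : ℝ) :
    ∫⁻ v : ℝ, ENNReal.ofReal (1 + (v ^ 2 - B) ^ 2)⁻¹ ≤
      ENNReal.ofReal (4 * Real.pi) * ENNReal.ofReal (jap √|B|)⁻¹ := by
  set a := √|B|
  have hB2 : |B| = a ^ 2 := by rw [Real.sq_sqrt (abs_nonneg _)]
  set c := jap a
  have hc : 0 < c := jap_pos a
  have hc2 : c ^ 2 = 1 + |B| := by rw [hB2]; exact jap_sq a
  have pt (v : ℝ) : ENNReal.ofReal (1 + (v ^ 2 - B) ^ 2)⁻¹ ≤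
      ENNReal.ofReal 2 * (ENNReal.ofReal (1 + (c * v + -(c * a)) ^ 2)⁻¹ +
        ENNReal.ofReal (1 + (c * v + c * a) ^ 2)⁻¹) := by
    rw [← ENNReal.ofReal_add (by positivity) (by positivity), ← ENNReal.ofReal_mul (by norm_num)]
    refine ENNReal.ofReal_le_ofReal ?_
    have h := one_add_sq_sub_ge v B
    rw [← hc2] at h
    have h1 : (1 + (v ^ 2 - B) ^ 2)⁻¹ ≤ 2 * (1 + c ^ 2 * (|v| - a) ^ 2)⁻¹ := by
      rw [show 2 * (1 + c ^ 2 * (|v| - a) ^ 2)⁻¹ = ((1 + c ^ 2 * (|v| - a) ^ 2) / 2)⁻¹ by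
        field_simp]
      exact inv_anti₀ (by positivity) h
    refine h1.trans (mul_le_mul_of_nonneg_left ?_ (by norm_num))
    have p1 : 0 ≤ (1 + (c * v + -(c * a)) ^ 2)⁻¹ := by positivity
    have p2 : 0 ≤ (1 + (c * v + c * a) ^ 2)⁻¹ := by positivity
    rcases abs_cases v with ⟨h, _⟩ | ⟨h, _⟩
    · rw [h, show c ^ 2 * (v - a) ^ 2 = (c * v + -(c * a)) ^ 2 by ring]; linarith
    · rw [h, show c ^ 2 * (-v - a) ^ 2 = (c * v + c * a) ^ 2 by ring]; linarith
  refine (lintegral_mono pt).trans ?_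
  rw [lintegral_const_mul _ (by fun_prop), lintegral_add_left (by fun_prop),
    lintegral_comp_mul_add (fun x => ENNReal.ofReal (1 + x ^ 2)⁻¹) hc,
    lintegral_comp_mul_add (fun x => ENNReal.ofReal (1 + x ^ 2)⁻¹) hc, lintegral_inv_one_add_sq,
    ← ENNReal.ofReal_mul (by positivity), ← ENNReal.ofReal_add (by positivity) (by positivity),
    ← ENNReal.ofReal_mul (by positivity), ← ENNReal.ofReal_mul (by positivity)]
  exact ENNReal.ofReal_le_ofReal (by linarith)

lemma inv_mul_rpow_neg_le {x y δ : ℝ} (hx : 1 ≤ x) (hy : 1 ≤ y) (hδ : 0 < δ) :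
    x⁻¹ * y ^ (-δ) ≤ x ^ (-(1 + δ)) + y ^ (-(1 + δ)) := by
  have hx0 : 0 < x := by linarith
  have hy0 : 0 < y := by linarith
  have e (z : ℝ) (hz : 0 < z) : z ^ (-(1 + δ)) = z⁻¹ * z ^ (-δ) := by
    rw [neg_add, Real.rpow_add hz, Real.rpow_neg_one]
  rw [e x hx0, e y hy0]
  have p1 : 0 < x ^ (-δ) := Real.rpow_pos_of_pos hx0 _
  have p2 : 0 < y ^ (-δ) := Real.rpow_pos_of_pos hy0 _
  rcases le_total x y with h | h
  · have : y ^ (-δ) ≤ x ^ (-δ) := Real.rpow_le_rpow_of_nonpos hx0 h (by linarith)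
    have := mul_le_mul_of_nonneg_left this (inv_pos.2 hx0).le
    have : 0 ≤ y⁻¹ * y ^ (-δ) := by positivity
    linarith
  · have : x⁻¹ ≤ y⁻¹ := inv_anti₀ hy0 h
    have := mul_le_mul_of_nonneg_right this p2.le
    have : 0 ≤ x⁻¹ * x ^ (-δ) := by positivity
    linarith

/-- Uniform integrability along hyperbolas against a single negative power weight. -/
lemma exists_hyperbola_bound {δ : ℝ} (hδ : 0 < δ) :
    ∃ C : ℝ≥0∞, C < ⊤ ∧ ∀ A c : ℝ, ∫⁻ u : ℝ, ∫⁻ v : ℝ,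
      ENNReal.ofReal ((1 + (v ^ 2 - u ^ 2 - A) ^ 2)⁻¹ * jap (u - c) ^ (-δ)) ≤ C := by
  set J := ∫⁻ x : ℝ, ENNReal.ofReal (jap x ^ (-(1 + δ)))
  have hJ : J < ⊤ := lintegral_jap_rpow_lt_top (by linarith)
  refine ⟨ENNReal.ofReal (4 * Real.pi) * (J + J + J),
    ENNReal.mul_lt_top ENNReal.ofReal_lt_top (by simp [hJ]), fun A c => ?_⟩
  set b := √|A|
  have inner (u : ℝ) : ∫⁻ v : ℝ,
      ENNReal.ofReal ((1 + (v ^ 2 - u ^ 2 - A) ^ 2)⁻¹ * jap (u - c) ^ (-δ)) ≤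
      ENNReal.ofReal (4 * Real.pi) * (ENNReal.ofReal (jap (u + -b) ^ (-(1 + δ))) +
        ENNReal.ofReal (jap (u + b) ^ (-(1 + δ))) +
        ENNReal.ofReal (jap (u + -c) ^ (-(1 + δ)))) := by
    have hj : 0 ≤ jap (u - c) ^ (-δ) := (Real.rpow_pos_of_pos (jap_pos _) _).le
    simp_rw [ENNReal.ofReal_mul' hj, sub_sub]
    rw [lintegral_mul_const _ (by fun_prop)]
    refine (mul_le_mul_left (lintegral_cauchy_sq_sub_le _) _).trans ?_
    rw [mul_assoc, ← ENNReal.ofReal_mul (inv_pos.2 (jap_pos _)).le]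
    gcongr
    have pj (x : ℝ) : 0 ≤ jap x ^ (-(1 + δ)) := (Real.rpow_pos_of_pos (jap_pos _) _).le
    rw [← ENNReal.ofReal_add (pj _) (pj _), ← ENNReal.ofReal_add (add_nonneg (pj _) (pj _)) (pj _)]
    refine ENNReal.ofReal_le_ofReal ?_
    refine (inv_mul_rpow_neg_le (one_le_jap _) (one_le_jap _) hδ).trans ?_
    rw [← sub_eq_add_neg u c]
    gcongr
    have hmono (x y : ℝ) (h : x ^ 2 ≤ y ^ 2) : jap y ^ (-(1 + δ)) ≤ jap x ^ (-(1 + δ)) :=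
      Real.rpow_le_rpow_of_nonpos (jap_pos x) (Real.sqrt_le_sqrt (by linarith)) (by linarith)
    have hb : b ^ 2 = |A| := Real.sq_sqrt (abs_nonneg _)
    have hb0 : 0 ≤ b := Real.sqrt_nonneg _
    have hs : (√|u ^ 2 + A|) ^ 2 = |u ^ 2 + A| := Real.sq_sqrt (abs_nonneg _)
    have hA : u ^ 2 - b ^ 2 ≤ |u ^ 2 + A| := by
      have := neg_abs_le A
      have := le_abs_self (u ^ 2 + A)
      linarith
    have hA' : b ^ 2 - u ^ 2 ≤ |u ^ 2 + A| := by
      rcases abs_cases A with ⟨h, _⟩ | ⟨h, _⟩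
      · have := le_abs_self (u ^ 2 + A)
        nlinarith [sq_nonneg u]
      · have := neg_abs_le (u ^ 2 + A)
        linarith
    rcases le_total 0 u with hu | hu
    · refine (hmono (u + -b) _ ?_).trans (le_add_of_nonneg_right (pj _))
      rw [hs]
      rcases le_total u b with h | h <;> nlinarith [mul_nonneg hb0 (sub_nonneg.2 h),
        mul_nonneg hu (sub_nonneg.2 h)]
    · refine (hmono (u + b) _ ?_).trans (le_add_of_nonneg_left (pj _))
      rw [hs]
      rcases le_total (-u) b with h | h <;> nlinarith [mul_nonneg hb0 (sub_nonneg.2 h),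
        mul_nonneg (neg_nonneg.2 hu) (sub_nonneg.2 h)]
  refine (lintegral_mono inner).trans ?_
  have m (d : ℝ) : Measurable fun u => ENNReal.ofReal (jap (u + d) ^ (-(1 + δ))) :=
    ((continuous_jap_rpow _).comp (continuous_add_const d)).measurable.ennreal_ofReal
  have m2 : Measurable fun u => ENNReal.ofReal (jap (u + -b) ^ (-(1 + δ))) +
      ENNReal.ofReal (jap (u + b) ^ (-(1 + δ))) := (m _).add (m _)
  rw [lintegral_const_mul _ (by exact m2.add (m _)), lintegral_add_left m2,
    lintegral_add_left (m _),
    lintegral_add_right_eq_self (fun u => ENNReal.ofReal (jap u ^ (-(1 + δ)))),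
    lintegral_add_right_eq_self (fun u => ENNReal.ofReal (jap u ^ (-(1 + δ)))),
    lintegral_add_right_eq_self (fun u => ENNReal.ofReal (jap u ^ (-(1 + δ))))]

lemma lintegral_lintegral_shear {f : ℝ → ℝ → ℝ≥0∞} (x : ℝ) :
    ∫⁻ b : ℝ, ∫⁻ a : ℝ, f (2 * a + (b - x)) (b + x) =
      ENNReal.ofReal 2⁻¹ * ∫⁻ u : ℝ, ∫⁻ v : ℝ, f v u := by
  rw [← lintegral_const_mul' _ _ ENNReal.ofReal_ne_top,
    ← lintegral_add_right_eq_self (fun u => ENNReal.ofReal 2⁻¹ * ∫⁻ v : ℝ, f v u) x]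
  exact lintegral_congr fun b => lintegral_comp_mul_add (fun v => f v (b + x)) two_pos _

/-- The quotient of Japanese brackets that governs the collapsing estimate. -/
def japRatio (ε x a b : ℝ) : ℝ :=
  (jap (x - a - b) ^ ε * jap a ^ ε * jap b ^ ε / jap x ^ ε) ^ 2

lemma japRatio_pos (ε x a b : ℝ) : 0 < japRatio ε x a b := by
  have h (y : ℝ) : 0 < jap y ^ ε := Real.rpow_pos_of_pos (jap_pos y) _
  have := h x; have := h a; have := h b; have := h (x - a - b)
  unfold japRatio; positivity

lemma continuous_japRatio (ε x : ℝ) : Continuous fun z : ℝ × ℝ => japRatio ε x z.1 z.2 := by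
  unfold japRatio
  have h := continuous_jap_rpow ε
  have h1 : Continuous fun z : ℝ × ℝ => jap (x - z.1 - z.2) ^ ε := h.comp (by fun_prop)
  have h2 : Continuous fun z : ℝ × ℝ => jap z.1 ^ ε := h.comp (by fun_prop)
  have h3 : Continuous fun z : ℝ × ℝ => jap z.2 ^ ε := h.comp (by fun_prop)
  fun_prop

lemma inv_japRatio_le {ε : ℝ} (hε : 0 < ε) (x a b : ℝ) :
    (japRatio ε x a b)⁻¹ ≤
      6 ^ (2 * ε) * (jap b ^ (-(2 * ε)) + jap (2 * a + (b - x)) ^ (-(2 * ε))) := by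
  set c := x - a - b with hc
  have h1 := one_le_jap a
  have h2 := one_le_jap b
  have h3 := one_le_jap c
  have hx := jap_pos x
  have hv : jap (2 * a + (b - x)) ≤ 2 * (jap a * jap c) := by
    rw [show 2 * a + (b - x) = a - c by rw [hc]; ring]; exact jap_sub_le a c
  have hx3 : jap x ≤ jap a + jap b + jap c := by
    have := jap_add_add_le a b c
    rwa [show a + b + c = x by rw [hc]; ring] at this
  have hvp := jap_pos (2 * a + (b - x))
  have e : (japRatio ε x a b)⁻¹ = (jap x / (jap c * jap a * jap b)) ^ (2 * ε) := by
    rw [japRatio, ← Real.mul_rpow (by positivity) (by positivity),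
      ← Real.mul_rpow (by positivity) (by positivity), ← Real.div_rpow (by positivity)
        (by positivity), ← Real.rpow_natCast, ← Real.rpow_mul (by positivity),
      ← Real.inv_rpow (by positivity), inv_div]
    congr 1; push_cast; ring
  have f (y : ℝ) (hy : 0 < y) : 6 ^ (2 * ε) * y ^ (-(2 * ε)) = (6 / y) ^ (2 * ε) := by
    rw [Real.div_rpow (by norm_num) hy.le, Real.rpow_neg hy.le, div_eq_mul_inv]
  have hac : 1 ≤ jap a * jap c := by nlinarith
  rw [e, mul_add, f _ (by linarith), f _ hvp]
  by_cases h : jap a ≤ jap b ∧ jap c ≤ jap b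
  · refine le_add_of_nonneg_of_le (by positivity) (Real.rpow_le_rpow (by positivity) ?_
      (by linarith))
    rw [div_le_div_iff₀ (by positivity) hvp]
    have : jap x ≤ 3 * jap b := by linarith
    calc jap x * jap (2 * a + (b - x)) ≤ (3 * jap b) * (2 * (jap a * jap c)) := by gcongr
      _ = _ := by ring
  · refine le_add_of_le_of_nonneg (Real.rpow_le_rpow (by positivity) ?_ (by linarith))
      (by positivity)
    rw [div_le_div_iff₀ (by positivity) (by linarith)]
    have : jap x ≤ 3 * (jap a * jap c) := by
      rcases not_and_or.1 h with h | h <;> rcases le_total (jap a) (jap c) with h' | h' <;>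
        nlinarith
    calc jap x * jap b ≤ 3 * (jap a * jap c) * jap b := by gcongr
      _ ≤ _ := by nlinarith [mul_pos (mul_pos (jap_pos a) (jap_pos c)) (jap_pos b)]

/-- The kernel bound behind the collapsing estimate: a smoothed version of
`sup_{s,x} ∫ δ(s - P) ⟨x⟩^{2ε} / (⟨x-a-b⟩ ⟨a⟩ ⟨b⟩)^{2ε} da db < ∞`. -/
lemma exists_kernel_bound {ε : ℝ} (hε : 0 < ε) :
    ∃ C : ℝ≥0∞, C < ⊤ ∧ ∀ x s : ℝ, ∫⁻ z : ℝ × ℝ,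
      ENNReal.ofReal ((1 + ((x - z.1 - z.2) ^ 2 + z.1 ^ 2 - z.2 ^ 2 - s) ^ 2)⁻¹ *
        (japRatio ε x z.1 z.2)⁻¹) ≤ C := by
  obtain ⟨C, hC, h⟩ := exists_hyperbola_bound (δ := 2 * ε) (by linarith)
  refine ⟨ENNReal.ofReal (4 * 6 ^ (2 * ε)) * (ENNReal.ofReal 2⁻¹ * (C + C)),
    ENNReal.mul_lt_top ENNReal.ofReal_lt_top (ENNReal.mul_lt_top ENNReal.ofReal_lt_top
      (by simp [hC])), fun x s => ?_⟩
  set A := 2 * (s - x ^ 2)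
  set f : ℝ → ℝ → ℝ≥0∞ := fun v u =>
    ENNReal.ofReal ((1 + (v ^ 2 - u ^ 2 - A) ^ 2)⁻¹ * jap (u - x) ^ (-(2 * ε))) with hf
  set g : ℝ → ℝ → ℝ≥0∞ := fun v u =>
    ENNReal.ofReal ((1 + (v ^ 2 - u ^ 2 - A) ^ 2)⁻¹ * jap v ^ (-(2 * ε))) with hg
  have jp (y : ℝ) : 0 ≤ jap y ^ (-(2 * ε)) := (Real.rpow_pos_of_pos (jap_pos y) _).le
  have jm : Measurable fun y => jap y ^ (-(2 * ε)) := (continuous_jap_rpow _).measurable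
  have hfm : Measurable fun p : ℝ × ℝ => f p.1 p.2 := by
    have : Measurable fun p : ℝ × ℝ => jap (p.2 - x) ^ (-(2 * ε)) := jm.comp (by fun_prop)
    fun_prop
  have hgm : Measurable fun p : ℝ × ℝ => g p.1 p.2 := by
    have : Measurable fun p : ℝ × ℝ => jap p.1 ^ (-(2 * ε)) := jm.comp (by fun_prop)
    fun_prop
  have pt (z : ℝ × ℝ) : ENNReal.ofReal ((1 + ((x - z.1 - z.2) ^ 2 + z.1 ^ 2 - z.2 ^ 2 - s) ^ 2)⁻¹ *
      (japRatio ε x z.1 z.2)⁻¹) ≤ ENNReal.ofReal (4 * 6 ^ (2 * ε)) *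
        (f (2 * z.1 + (z.2 - x)) (z.2 + x) + g (2 * z.1 + (z.2 - x)) (z.2 + x)) := by
    obtain ⟨a, b⟩ := z
    rw [hf, hg]
    dsimp only
    rw [← ENNReal.ofReal_add (mul_nonneg (by positivity) (jp _))
      (mul_nonneg (by positivity) (jp _)), ← ENNReal.ofReal_mul (by positivity)]
    refine ENNReal.ofReal_le_ofReal ?_
    set R := (2 * a + (b - x)) ^ 2 - (b + x) ^ 2 - A with hR
    have hk : (1 + ((x - a - b) ^ 2 + a ^ 2 - b ^ 2 - s) ^ 2)⁻¹ ≤ 4 * (1 + R ^ 2)⁻¹ := by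
      have : (x - a - b) ^ 2 + a ^ 2 - b ^ 2 - s = R / 2 := by rw [hR]; ring
      rw [this, show 4 * (1 + R ^ 2)⁻¹ = ((1 + R ^ 2) / 4)⁻¹ by field_simp]
      exact inv_anti₀ (by positivity) (by linarith)
    calc _ ≤ (4 * (1 + R ^ 2)⁻¹) *
          (6 ^ (2 * ε) * (jap b ^ (-(2 * ε)) + jap (2 * a + (b - x)) ^ (-(2 * ε)))) :=
          mul_le_mul hk (inv_japRatio_le hε x a b) (inv_pos.2 (japRatio_pos _ _ _ _)).le
            (by positivity)
      _ = _ := by rw [show b + x - x = b by ring]; ring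
  refine (lintegral_mono pt).trans ?_
  have hfm' : Measurable fun z : ℝ × ℝ => f (2 * z.1 + (z.2 - x)) (z.2 + x) :=
    hfm.comp (g := fun p : ℝ × ℝ => f p.1 p.2)
      (f := fun z : ℝ × ℝ => (2 * z.1 + (z.2 - x), z.2 + x)) (by fun_prop)
  have hgm' : Measurable fun z : ℝ × ℝ => g (2 * z.1 + (z.2 - x)) (z.2 + x) :=
    hgm.comp (g := fun p : ℝ × ℝ => g p.1 p.2)
      (f := fun z : ℝ × ℝ => (2 * z.1 + (z.2 - x), z.2 + x)) (by fun_prop)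
  rw [lintegral_const_mul _ (by exact hfm'.add hgm'), lintegral_add_left hfm',
    Measure.volume_eq_prod, lintegral_prod_symm' _ hfm', lintegral_prod_symm' _ hgm']
  dsimp only
  rw [lintegral_lintegral_shear, lintegral_lintegral_shear, ← mul_add]
  gcongr
  · exact h A x
  · rw [lintegral_lintegral_swap (f := fun u v => g v u)
      (hgm.comp measurable_swap).aemeasurable]
    refine le_trans (le_of_eq ?_) (h (-A) 0)
    refine lintegral_congr fun v => lintegral_congr fun u => ?_
    rw [hg, sub_zero, show u ^ 2 - v ^ 2 - -A = -(v ^ 2 - u ^ 2 - A) by ring, neg_sq]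

/-- The oscillatory integral `∫ e^{-iτP(z)} g(z) dμ(z)`. -/
def oscInt {Z : Type*} [MeasurableSpace Z] (μ : Measure Z) (P : Z → ℝ) (g : Z → ℂ) (τ : ℝ) : ℂ :=
  ∫ z, cexp (-(I * ((τ * P z : ℝ) : ℂ))) * g z ∂μ

lemma exp_neg_le_inv_one_add {x : ℝ} (hx : 0 ≤ x) : Real.exp (-x) ≤ (1 + x)⁻¹ := by
  rw [Real.exp_neg]
  exact inv_anti₀ (by linarith) (by linarith [Real.add_one_le_exp x])

lemma exp_neg_sq_div_le {b : ℝ} (hb : 0 < b) (s : ℝ) :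
    Real.exp (-(s ^ 2 / (4 * b))) ≤ (1 + 4 * b) * (1 + s ^ 2)⁻¹ := by
  refine (exp_neg_le_inv_one_add (by positivity)).trans ?_
  rw [← div_eq_mul_inv, inv_eq_one_div, div_le_div_iff₀ (by positivity) (by positivity)]
  have : 4 * b * (s ^ 2 / (4 * b)) = s ^ 2 := by field_simp
  have : 0 ≤ s ^ 2 / (4 * b) := by positivity
  nlinarith

/-- Gaussian-regularised `TT*` bound for an oscillatory integral. -/
lemma lintegral_gaussian_mul_oscInt_le {Z : Type*} [MeasurableSpace Z] (μ : Measure Z) [SFinite μ]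
    {b : ℝ} (hb : 0 < b) {P : Z → ℝ} (hP : Measurable P) {g : Z → ℂ} (hg : Integrable g μ) :
    ∫⁻ τ : ℝ, ENNReal.ofReal (Real.exp (-b * τ ^ 2) * ‖oscInt μ P g τ‖ ^ 2) ≤
      ∫⁻ p, ENNReal.ofReal (√(Real.pi / b) * (1 + 4 * b) * (1 + (P p.2 - P p.1) ^ 2)⁻¹ *
        (‖g p.1‖ * ‖g p.2‖)) ∂(μ.prod μ) := by
  set Ψ : ℝ × (Z × Z) → ℂ := fun q => cexp (-(I * ((q.1 * (P q.2.1 - P q.2.2) : ℝ) : ℂ))) *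
    (cexp (-b * (q.1 : ℂ) ^ 2) * (g q.2.1 * (starRingEnd ℂ) (g q.2.2))) with hΨ
  have hgc : Integrable (fun z => (starRingEnd ℂ) (g z)) μ :=
    (LinearIsometryEquiv.integrable_comp_iff conjLIE).2 hg
  have hgg : Integrable (fun p : Z × Z => g p.1 * (starRingEnd ℂ) (g p.2)) (μ.prod μ) :=
    hg.mul_prod hgc
  have hΨi : Integrable Ψ (volume.prod (μ.prod μ)) := by
    have h1 : Integrable (fun q : ℝ × (Z × Z) => cexp (-b * (q.1 : ℂ) ^ 2) *
        (g q.2.1 * (starRingEnd ℂ) (g q.2.2))) (volume.prod (μ.prod μ)) :=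
      (integrable_cexp_neg_mul_sq (b := (b : ℂ)) (by simpa using hb)).mul_prod hgg
    refine h1.bdd_mul (c := 1) (Measurable.aestronglyMeasurable (by fun_prop))
      (Filter.Eventually.of_forall fun q => ?_)
    rw [← mul_neg, ← ofReal_neg, mul_comm, Complex.norm_exp_ofReal_mul_I]
  have hinner (τ : ℝ) : ∫ p, Ψ (τ, p) ∂(μ.prod μ) =
      ((Real.exp (-b * τ ^ 2) * ‖oscInt μ P g τ‖ ^ 2 : ℝ) : ℂ) := by
    have h2 : (starRingEnd ℂ) (oscInt μ P g τ) =
        ∫ z, cexp (I * ((τ * P z : ℝ) : ℂ)) * (starRingEnd ℂ) (g z) ∂μ := by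
      rw [oscInt, ← integral_conj]
      refine integral_congr_ae (Filter.Eventually.of_forall fun z => ?_)
      simp [← exp_conj]
    have h3 : ((‖oscInt μ P g τ‖ ^ 2 : ℝ) : ℂ) =
        oscInt μ P g τ * (starRingEnd ℂ) (oscInt μ P g τ) := by
      rw [mul_conj, normSq_eq_norm_sq]
    rw [ofReal_mul, h3, h2, oscInt, ← integral_prod_mul, ← integral_const_mul]
    refine integral_congr_ae (Filter.Eventually.of_forall fun p => ?_)
    simp only [hΨ]
    have : cexp (-(I * ((τ * (P p.1 - P p.2) : ℝ) : ℂ))) =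
        cexp (-(I * ((τ * P p.1 : ℝ) : ℂ))) * cexp (I * ((τ * P p.2 : ℝ) : ℂ)) := by
      rw [← Complex.exp_add]; congr 1; push_cast; ring
    rw [this]; push_cast; ring
  have houter (p : Z × Z) : ∫ τ : ℝ, Ψ (τ, p) = ((√(Real.pi / b) : ℝ) : ℂ) *
      ((Real.exp (-((P p.1 - P p.2) ^ 2 / (4 * b))) : ℝ) : ℂ) *
      (g p.1 * (starRingEnd ℂ) (g p.2)) := by
    have h4 := fourierIntegral_gaussian (b := (b : ℂ)) (by simpa using hb)
      ((-(P p.1 - P p.2) : ℝ) : ℂ)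
    have h5 : ((Real.pi : ℂ) / b) ^ (1 / 2 : ℂ) = ((√(Real.pi / b) : ℝ) : ℂ) := by
      rw [Real.sqrt_eq_rpow, ofReal_cpow (by positivity)]; push_cast; rfl
    have h6 : cexp (-((-(P p.1 - P p.2) : ℝ) : ℂ) ^ 2 / (4 * b)) =
        ((Real.exp (-((P p.1 - P p.2) ^ 2 / (4 * b))) : ℝ) : ℂ) := by
      push_cast; congr 1; ring
    rw [← h5, ← h6, ← h4, ← integral_mul_const]
    refine integral_congr_ae (Filter.Eventually.of_forall fun τ => ?_)
    simp only [hΨ]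
    rw [show -(I * ((τ * (P p.1 - P p.2) : ℝ) : ℂ)) =
      I * ((-(P p.1 - P p.2) : ℝ) : ℂ) * τ by push_cast; ring]
    ring
  have hswap : ∫ τ : ℝ, ∫ p, Ψ (τ, p) ∂(μ.prod μ) = ∫ p, (∫ τ : ℝ, Ψ (τ, p)) ∂(μ.prod μ) :=
    integral_integral_swap hΨi
  have hreal : Integrable fun τ : ℝ => Real.exp (-b * τ ^ 2) * ‖oscInt μ P g τ‖ ^ 2 := by
    have h7 := hΨi.integral_prod_left.re
    simp only [hinner] at h7
    exact h7
  rw [← ofReal_integral_eq_lintegral_ofReal hreal (Filter.Eventually.of_forall fun τ => by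
    positivity)]
  have h8 : ((∫ τ : ℝ, Real.exp (-b * τ ^ 2) * ‖oscInt μ P g τ‖ ^ 2 : ℝ) : ℂ) =
      ∫ p, (∫ τ : ℝ, Ψ (τ, p)) ∂(μ.prod μ) := by
    rw [← hswap]
    refine integral_complex_ofReal.symm.trans ?_
    exact integral_congr_ae (Filter.Eventually.of_forall fun τ => (hinner τ).symm)
  have h9 : ENNReal.ofReal (∫ τ : ℝ, Real.exp (-b * τ ^ 2) * ‖oscInt μ P g τ‖ ^ 2) =
      ‖∫ p, (∫ τ : ℝ, Ψ (τ, p)) ∂(μ.prod μ)‖ₑ := by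
    rw [← h8, ← ofReal_norm, norm_real, Real.norm_of_nonneg
      (integral_nonneg fun τ => by positivity)]
  rw [h9]
  refine (enorm_integral_le_lintegral_enorm _).trans (lintegral_mono fun p => ?_)
  rw [houter, ← ofReal_norm]
  refine ENNReal.ofReal_le_ofReal ?_
  rw [norm_mul, norm_mul, norm_real, norm_real, Real.norm_of_nonneg (Real.sqrt_nonneg _),
    Real.norm_of_nonneg (Real.exp_pos _).le, norm_mul, RCLike.norm_conj]
  have := exp_neg_sq_div_le hb (P p.1 - P p.2)
  rw [← neg_sub (P p.2), neg_sq] at this ⊢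
  refine mul_le_mul_of_nonneg_right ?_ (by positivity)
  rw [mul_assoc]
  exact mul_le_mul_of_nonneg_left this (Real.sqrt_nonneg _)

/-- Local-in-time `L²` bound for an oscillatory integral under a weighted level-set condition. -/
lemma lintegral_Ioc_oscInt_sq_le {Z : Type*} [MeasurableSpace Z] (μ : Measure Z) [SFinite μ]
    {T : ℝ} (hT : 0 < T) {P : Z → ℝ} (hP : Measurable P) {g : Z → ℂ} (hg : Integrable g μ)
    (hgm : Measurable g) {ω : Z → ℝ} (hωm : Measurable ω) (hω : ∀ z, 0 < ω z) {M : ℝ≥0∞}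
    (hM : ∀ s, ∫⁻ z, ENNReal.ofReal ((1 + (P z - s) ^ 2)⁻¹ * (ω z)⁻¹) ∂μ ≤ M) :
    ∫⁻ τ in Set.Ioc 0 T, ‖oscInt μ P g τ‖ₑ ^ 2 ≤
      ENNReal.ofReal (2 * Real.exp 1 * (√(Real.pi * T ^ 2) * (1 + 4 / T ^ 2))) * M *
        ∫⁻ z, ENNReal.ofReal (ω z) * ‖g z‖ₑ ^ 2 ∂μ := by
  set b := 1 / T ^ 2 with hb
  have hb0 : 0 < b := by positivity
  set κ := √(Real.pi * T ^ 2) * (1 + 4 / T ^ 2) with hκ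
  have hκb : √(Real.pi / b) * (1 + 4 * b) = κ := by
    rw [hκ, hb]; congr 2 <;> field_simp
  have hκ0 : 0 ≤ κ := by positivity
  have hgauss : ∫⁻ τ in Set.Ioc 0 T, ‖oscInt μ P g τ‖ₑ ^ 2 ≤ ENNReal.ofReal (Real.exp 1) *
      ∫⁻ τ : ℝ, ENNReal.ofReal (Real.exp (-b * τ ^ 2) * ‖oscInt μ P g τ‖ ^ 2) := by
    rw [← lintegral_const_mul' _ _ ENNReal.ofReal_ne_top]
    refine (setLIntegral_mono' measurableSet_Ioc fun τ hτ => ?_).trans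
      (setLIntegral_le_lintegral (Set.Ioc 0 T) _)
    rw [← ofReal_norm, ← ENNReal.ofReal_pow (norm_nonneg _),
      ← ENNReal.ofReal_mul (Real.exp_pos _).le, ← mul_assoc, ← Real.exp_add]
    refine ENNReal.ofReal_le_ofReal (le_mul_of_one_le_left (by positivity) (Real.one_le_exp ?_))
    have : τ ^ 2 ≤ T ^ 2 := pow_le_pow_left₀ hτ.1.le hτ.2 2
    have : b * τ ^ 2 ≤ 1 := by
      rw [hb, one_div_mul_eq_div, div_le_one (by positivity)]; exact this
    linarith
  set A : Z → Z → ℝ≥0∞ := fun z w => ENNReal.ofReal (κ * (ω z * ‖g z‖ ^ 2)) *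
    ENNReal.ofReal ((1 + (P w - P z) ^ 2)⁻¹ * (ω w)⁻¹) with hA
  have hAm : Measurable fun p : Z × Z => A p.1 p.2 := by fun_prop
  have hAle : ∫⁻ p, A p.1 p.2 ∂(μ.prod μ) ≤
      ENNReal.ofReal κ * M * ∫⁻ z, ENNReal.ofReal (ω z) * ‖g z‖ₑ ^ 2 ∂μ := by
    rw [lintegral_prod _ hAm.aemeasurable, ← lintegral_const_mul _ (by fun_prop)]
    refine lintegral_mono fun z => ?_
    dsimp only [hA]
    rw [lintegral_const_mul _ (by fun_prop), ENNReal.ofReal_mul hκ0, ENNReal.ofReal_mul (hω z).le,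
      ENNReal.ofReal_pow (norm_nonneg _), ofReal_norm, mul_right_comm (ENNReal.ofReal κ)]
    gcongr
    exact hM _
  have hsymm : ∫⁻ p, ENNReal.ofReal (κ * (1 + (P p.2 - P p.1) ^ 2)⁻¹ * (‖g p.1‖ * ‖g p.2‖))
      ∂(μ.prod μ) ≤ ∫⁻ p, A p.1 p.2 ∂(μ.prod μ) + ∫⁻ p, A p.1 p.2 ∂(μ.prod μ) := by
    have hsw : ∫⁻ p, A p.1 p.2 ∂(μ.prod μ) = ∫⁻ p, A p.2 p.1 ∂(μ.prod μ) :=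
      (lintegral_prod_swap (fun p : Z × Z => A p.1 p.2)).symm
    nth_rewrite 2 [hsw]
    rw [← lintegral_add_left hAm]
    refine lintegral_mono fun p => ?_
    obtain ⟨z, w⟩ := p
    have h1 := hω z
    have h2 := hω w
    simp only [hA]
    rw [← ENNReal.ofReal_mul (by positivity), ← ENNReal.ofReal_mul (by positivity),
      ← ENNReal.ofReal_add (by positivity) (by positivity)]
    refine ENNReal.ofReal_le_ofReal ?_
    rw [← neg_sub (P w) (P z), neg_sq]
    have key : ‖g z‖ * ‖g w‖ ≤ ω z * ‖g z‖ ^ 2 * (ω w)⁻¹ + ω w * ‖g w‖ ^ 2 * (ω z)⁻¹ := by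
      have e : ω z * ‖g z‖ ^ 2 * (ω w)⁻¹ + ω w * ‖g w‖ ^ 2 * (ω z)⁻¹ =
          ((ω z * ‖g z‖) ^ 2 + (ω w * ‖g w‖) ^ 2) / (ω z * ω w) := by field_simp
      rw [e, le_div_iff₀ (by positivity)]
      nlinarith [sq_nonneg (ω z * ‖g z‖ - ω w * ‖g w‖), mul_nonneg (mul_nonneg h1.le
        (norm_nonneg (g z))) (mul_nonneg h2.le (norm_nonneg (g w)))]
    calc _ ≤ κ * (1 + (P w - P z) ^ 2)⁻¹ *
          (ω z * ‖g z‖ ^ 2 * (ω w)⁻¹ + ω w * ‖g w‖ ^ 2 * (ω z)⁻¹) := by gcongr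
      _ = _ := by ring
  have hdouble := lintegral_gaussian_mul_oscInt_le μ hb0 hP hg
  rw [hκb] at hdouble
  calc _ ≤ ENNReal.ofReal (Real.exp 1) * (ENNReal.ofReal κ * M *
        (∫⁻ z, ENNReal.ofReal (ω z) * ‖g z‖ₑ ^ 2 ∂μ) + ENNReal.ofReal κ * M *
        ∫⁻ z, ENNReal.ofReal (ω z) * ‖g z‖ₑ ^ 2 ∂μ) :=
        hgauss.trans (mul_le_mul_right (hdouble.trans (hsymm.trans (add_le_add hAle hAle))) _)
    _ = _ := by
      rw [mul_assoc 2, ENNReal.ofReal_mul two_pos.le, ENNReal.ofReal_mul (Real.exp_pos _).le,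
        ENNReal.ofReal_ofNat]
      ring

section Plancherel

open scoped FourierTransform ContDiff

variable {V : Type*} [NormedAddCommGroup V] [InnerProductSpace ℝ V] [FiniteDimensional ℝ V]
  [MeasurableSpace V] [BorelSpace V]

lemma continuous_fourier_of_integrable {f : V → ℂ} (hf : Integrable f) : Continuous (𝓕 f) :=
  VectorFourier.fourierIntegral_continuous Real.continuous_fourierChar continuous_inner hf

lemma coeFn_fourier_toLp_ae_eq {f : V → ℂ} (hf : Integrable f) (hf2 : MemLp f 2) :
    ⇑(𝓕 (hf2.toLp f) : Lp (α := V) ℂ 2) =ᵐ[volume] 𝓕 f := by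
  refine ae_eq_of_integral_contDiff_smul_eq
    ((Lp.memLp _).locallyIntegrable one_le_two)
    (continuous_fourier_of_integrable hf).locallyIntegrable fun g hg hgc => ?_
  have hgc' : HasCompactSupport fun x => (g x : ℂ) := hgc.comp_left ofReal_zero
  have hg' : ContDiff ℝ ∞ fun x => (g x : ℂ) := ofRealCLM.contDiff.comp hg
  set ψ : SchwartzMap V ℂ := hgc'.toSchwartzMap hg' with hψ
  have hψg (x : V) : ψ x = (g x : ℂ) := rfl
  have h1 := DFunLike.congr_fun (Lp.fourier_toTemperedDistribution_eq (hf2.toLp f)) ψ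
  rw [TemperedDistribution.fourier_apply, Lp.toTemperedDistribution_apply,
    Lp.toTemperedDistribution_apply] at h1
  have h2 : ∫ x, (𝓕 ψ) x • (hf2.toLp f) x = ∫ x, (𝓕 ψ) x • f x :=
    integral_congr_ae (hf2.coeFn_toLp.mono fun x hx => by simp only [hx])
  have h3 : ∫ x, (𝓕 ψ) x • f x = ∫ x, ψ x • 𝓕 f x := by
    rw [SchwartzMap.fourier_coe]
    have := VectorFourier.integral_fourierIntegral_smul_eq_flip (μ := volume) (ν := volume)
      (L := innerₗ V) Real.continuous_fourierChar continuous_inner ψ.integrable hf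
    rwa [flip_innerₗ] at this
  simpa only [hψg, h2, h3, Complex.real_smul, smul_eq_mul] using (h1.symm.trans (h2.trans h3))

/-- Plancherel's theorem for functions in `L¹ ∩ L²`. -/
lemma lintegral_enorm_fourier_sq {f : V → ℂ} (hf : Integrable f) (hf2 : MemLp f 2) :
    ∫⁻ v, ‖𝓕 f v‖ₑ ^ 2 = ∫⁻ v, ‖f v‖ₑ ^ 2 := by
  have h1 : eLpNorm (𝓕 f) 2 volume = eLpNorm f 2 volume := by
    rw [← eLpNorm_congr_ae (coeFn_fourier_toLp_ae_eq hf hf2), ← eLpNorm_congr_ae hf2.coeFn_toLp,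
      ← Lp.enorm_def, ← Lp.enorm_def, ← ofReal_norm, ← ofReal_norm, Lp.norm_fourier_eq]
  have h2 (h : V → ℂ) : ∫⁻ v, ‖h v‖ₑ ^ 2 = eLpNorm h 2 volume ^ (2 : ℝ) := by
    rw [eLpNorm_eq_lintegral_rpow_enorm_toReal two_ne_zero ENNReal.ofNat_ne_top, ← ENNReal.rpow_mul]
    simp
  rw [h2, h2, h1]

end Plancherel

section Transport

open scoped FourierTransform

/-- The volume-preserving splitting of `ℝ^{2k}` as `ℝ^k × ℝ^k`. -/
def splitE (k : ℕ) :
    EuclideanSpace ℝ (Fin k ⊕ Fin k) ≃L[ℝ] (Fin k → ℝ) × (Fin k → ℝ) :=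
  (EuclideanSpace.equiv (Fin k ⊕ Fin k) ℝ).trans
    (ContinuousLinearEquiv.sumPiEquivProdPi ℝ (Fin k) (Fin k) fun _ => ℝ)

@[simp] lemma splitE_fst (k : ℕ) (x : EuclideanSpace ℝ (Fin k ⊕ Fin k)) (i : Fin k) :
    (splitE k x).1 i = x (Sum.inl i) := rfl

@[simp] lemma splitE_snd (k : ℕ) (x : EuclideanSpace ℝ (Fin k ⊕ Fin k)) (i : Fin k) :
    (splitE k x).2 i = x (Sum.inr i) := rfl

lemma measurePreserving_splitE (k : ℕ) : MeasurePreserving (splitE k) volume volume :=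
  (volume_measurePreserving_sumPiEquivProdPi fun _ : Fin k ⊕ Fin k => ℝ).comp
    (PiLp.volume_preserving_ofLp (Fin k ⊕ Fin k))

lemma measurableEmbedding_splitE (k : ℕ) : MeasurableEmbedding (splitE k) :=
  (splitE k).toHomeomorph.measurableEmbedding

lemma inner_eq_dotR {k : ℕ} (x y : EuclideanSpace ℝ (Fin k ⊕ Fin k)) :
    inner ℝ x y = dotR (splitE k x).1 (splitE k y).1 + dotR (splitE k x).2 (splitE k y).2 := by
  simp [PiLp.inner_apply, dotR, Fintype.sum_sum_type, mul_comm]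

/-- The splitting composed with the dilation by `2π`. -/
def dilEquiv (k : ℕ) :
    EuclideanSpace ℝ (Fin k ⊕ Fin k) ≃L[ℝ] (Fin k → ℝ) × (Fin k → ℝ) :=
  (ContinuousLinearEquiv.smulLeft (Units.mk0 (2 * Real.pi) Real.two_pi_pos.ne')).trans (splitE k)

lemma dilEquiv_apply (k : ℕ) (x : EuclideanSpace ℝ (Fin k ⊕ Fin k)) :
    dilEquiv k x = splitE k ((2 * Real.pi) • x) := rfl

lemma measurableEmbedding_dilEquiv (k : ℕ) : MeasurableEmbedding (dilEquiv k) :=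
  (dilEquiv k).toHomeomorph.measurableEmbedding

lemma map_dilEquiv (k : ℕ) : Measure.map (dilEquiv k) volume =
    ENNReal.ofReal (((2 * Real.pi) ^ (2 * k))⁻¹) •
      (volume : Measure ((Fin k → ℝ) × (Fin k → ℝ))) := by
  have h1 : (dilEquiv k : _ → _) = splitE k ∘ fun x => (2 * Real.pi) • x := rfl
  rw [h1, ← Measure.map_map (splitE k).continuous.measurable (by fun_prop),
    Measure.map_addHaar_smul _ Real.two_pi_pos.ne', Measure.map_smul,
    (measurePreserving_splitE k).map_eq, finrank_euclideanSpace, Fintype.card_sum, Fintype.card_fin,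
    ← two_mul, abs_of_pos (by positivity)]

/-- Inverse Fourier transform in the normalisation of `ftK`. -/
def invK (k : ℕ) (g : (Fin k → ℝ) × (Fin k → ℝ) → ℂ) (y : (Fin k → ℝ) × (Fin k → ℝ)) : ℂ :=
  (((2 * Real.pi) ^ (2 * k))⁻¹ : ℝ) • ∫ ξ : (Fin k → ℝ) × (Fin k → ℝ),
    cexp (I * ((dotR y.1 ξ.1 + dotR y.2 ξ.2 : ℝ) : ℂ)) * g ξ

lemma ftK_dilEquiv (k : ℕ) (f : (Fin k → ℝ) × (Fin k → ℝ) → ℂ)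
    (x : EuclideanSpace ℝ (Fin k ⊕ Fin k)) : ftK k f (dilEquiv k x) = 𝓕 (f ∘ splitE k) x := by
  rw [ftK, Real.fourier_eq', ← (measurePreserving_splitE k).integral_comp
    (measurableEmbedding_splitE k)]
  refine integral_congr_ae (Filter.Eventually.of_forall fun v => ?_)
  simp only [dilEquiv_apply, ← inner_eq_dotR, inner_smul_right, Function.comp_apply, smul_eq_mul]
  congr 2; push_cast; ring

lemma invK_splitE (k : ℕ) (g : (Fin k → ℝ) × (Fin k → ℝ) → ℂ)
    (x : EuclideanSpace ℝ (Fin k ⊕ Fin k)) : invK k g (splitE k x) = 𝓕⁻ (g ∘ dilEquiv k) x := by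
  have h1 : ∀ F : (Fin k → ℝ) × (Fin k → ℝ) → ℂ, ∫ v, F (dilEquiv k v) =
      (((2 * Real.pi) ^ (2 * k))⁻¹ : ℝ) • ∫ ξ, F ξ := fun F => by
    rw [← (measurableEmbedding_dilEquiv k).integral_map, map_dilEquiv, integral_smul_measure,
      ENNReal.toReal_ofReal (by positivity)]
  rw [invK, Real.fourierInv_eq', ← h1]
  refine integral_congr_ae (Filter.Eventually.of_forall fun v => ?_)
  simp only [dilEquiv_apply, ← inner_eq_dotR, inner_smul_right, Function.comp_apply, smul_eq_mul]
  congr 2; rw [real_inner_comm]; push_cast; ring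

lemma lintegral_comp_dilEquiv (k : ℕ) (F : (Fin k → ℝ) × (Fin k → ℝ) → ℝ≥0∞) :
    ∫⁻ v, F (dilEquiv k v) = ENNReal.ofReal (((2 * Real.pi) ^ (2 * k))⁻¹) * ∫⁻ ξ, F ξ := by
  rw [← (measurableEmbedding_dilEquiv k).lintegral_map, map_dilEquiv, lintegral_smul_measure,
    smul_eq_mul]

lemma integrable_comp_dilEquiv {k : ℕ} {g : (Fin k → ℝ) × (Fin k → ℝ) → ℂ} (hg : Integrable g) :
    Integrable (g ∘ dilEquiv k) := by
  rw [← (measurableEmbedding_dilEquiv k).integrable_map_iff, map_dilEquiv]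
  exact hg.smul_measure ENNReal.ofReal_ne_top

lemma memLp_comp_dilEquiv {k : ℕ} {g : (Fin k → ℝ) × (Fin k → ℝ) → ℂ} (hg : MemLp g 2) :
    MemLp (g ∘ dilEquiv k) 2 := by
  rw [← (measurableEmbedding_dilEquiv k).memLp_map_measure_iff, map_dilEquiv]
  exact hg.smul_measure ENNReal.ofReal_ne_top

/-- Plancherel's identity for `invK`. -/
lemma lintegral_enorm_invK_sq {k : ℕ} {g : (Fin k → ℝ) × (Fin k → ℝ) → ℂ} (hg : Integrable g)
    (hg2 : MemLp g 2) : ∫⁻ y, ‖invK k g y‖ₑ ^ 2 =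
      ENNReal.ofReal (((2 * Real.pi) ^ (2 * k))⁻¹) * ∫⁻ ξ, ‖g ξ‖ₑ ^ 2 := by
  rw [← (measurePreserving_splitE k).lintegral_comp_emb (measurableEmbedding_splitE k)]
  simp only [invK_splitE, Real.fourierInv_eq_fourier_neg]
  rw [lintegral_neg_eq_self fun v => ‖𝓕 (g ∘ dilEquiv k) v‖ₑ ^ 2,
    lintegral_enorm_fourier_sq (integrable_comp_dilEquiv hg) (memLp_comp_dilEquiv hg2),
    ← lintegral_comp_dilEquiv]
  rfl

lemma invK_eq_zero_of_not_integrable {k : ℕ} {g : (Fin k → ℝ) × (Fin k → ℝ) → ℂ}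
    (hg : ¬ Integrable g) : invK k g = 0 := by
  ext y
  rw [invK, integral_undef, smul_zero, Pi.zero_apply]
  intro h
  refine hg ?_
  have h2 := h.bdd_mul (c := 1)
    (f := fun ξ : (Fin k → ℝ) × (Fin k → ℝ) =>
      cexp (-(I * ((dotR y.1 ξ.1 + dotR y.2 ξ.2 : ℝ) : ℂ))))
    (Continuous.aestronglyMeasurable (by unfold dotR; fun_prop))
    (Filter.Eventually.of_forall fun ξ => by
      rw [← mul_neg, ← ofReal_neg, mul_comm, Complex.norm_exp_ofReal_mul_I])
  refine h2.congr (Filter.Eventually.of_forall fun ξ => ?_)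
  simp only [← mul_assoc, ← Complex.exp_add, neg_add_cancel, Complex.exp_zero, one_mul]

lemma lintegral_enorm_invK_sq_le {k : ℕ} (g : (Fin k → ℝ) × (Fin k → ℝ) → ℂ) :
    ∫⁻ y, ‖invK k g y‖ₑ ^ 2 ≤
      ENNReal.ofReal (((2 * Real.pi) ^ (2 * k))⁻¹) * ∫⁻ ξ, ‖g ξ‖ₑ ^ 2 := by
  by_cases hg : Integrable g
  swap
  · simp [invK_eq_zero_of_not_integrable hg]
  by_cases hg2 : ∫⁻ ξ, ‖g ξ‖ₑ ^ 2 = ⊤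
  · rw [hg2, ENNReal.mul_top (by simp; positivity)]
    exact le_top
  refine (lintegral_enorm_invK_sq hg ⟨hg.1, ?_⟩).le
  rw [eLpNorm_lt_top_iff_lintegral_rpow_enorm_lt_top two_ne_zero ENNReal.ofNat_ne_top]
  simpa using Ne.lt_top hg2

lemma norm_ftK_invK_le {k : ℕ} {h : (Fin k → ℝ) × (Fin k → ℝ) → ℂ} (hc : Continuous h)
    (hi : Integrable h) (ξ : (Fin k → ℝ) × (Fin k → ℝ)) : ‖ftK k (invK k h) ξ‖ ≤ ‖h ξ‖ := by
  obtain ⟨x, rfl⟩ := (dilEquiv k).surjective ξ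
  have h1 : invK k h ∘ splitE k = 𝓕⁻ (h ∘ dilEquiv k) := funext fun v => invK_splitE k h v
  rw [ftK_dilEquiv, h1]
  by_cases hI : Integrable (𝓕⁻ (h ∘ dilEquiv k))
  · have h2 : Integrable (𝓕 (h ∘ dilEquiv k)) := by
      refine hI.comp_neg.congr (Filter.Eventually.of_forall fun v => ?_)
      simp [Real.fourierInv_eq_fourier_neg]
    rw [Continuous.fourier_fourierInv_eq (hc.comp (dilEquiv k).continuous)
      (integrable_comp_dilEquiv hi) h2]
    rfl
  · rw [Real.fourier_eq, integral_undef, norm_zero]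
    · exact norm_nonneg _
    · rwa [Real.fourierIntegral_convergent_iff]

end Transport

instance isAddHaarMeasure_volume_prod (k l : ℕ) :
    (volume : Measure ((Fin k → ℝ) × (Fin l → ℝ))).IsAddHaarMeasure :=
  Measure.prod.instIsAddHaarMeasure _ _

open scoped FourierTransform in
/-- The transform `ftK` of a Schwartz function, as a Schwartz function. -/
def ftSchwartz (k : ℕ) (φ : SchwartzMap ((Fin k → ℝ) × (Fin k → ℝ)) ℂ) :
    SchwartzMap ((Fin k → ℝ) × (Fin k → ℝ)) ℂ :=
  SchwartzMap.compCLMOfContinuousLinearEquiv ℂ (dilEquiv k).symm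
    (𝓕 (SchwartzMap.compCLMOfContinuousLinearEquiv ℂ (splitE k) φ))

lemma coe_ftSchwartz (k : ℕ) (φ : SchwartzMap ((Fin k → ℝ) × (Fin k → ℝ)) ℂ) :
    ⇑(ftSchwartz k φ) = ftK k φ := by
  ext ξ
  obtain ⟨x, rfl⟩ := (dilEquiv k).surjective ξ
  rw [ftK_dilEquiv, ftSchwartz, SchwartzMap.compCLMOfContinuousLinearEquiv_apply,
    Function.comp_apply, ContinuousLinearEquiv.symm_apply_apply, SchwartzMap.fourier_coe]
  rfl

/-- The symbol of `R_ε^{(k)}`. -/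
def wt (ε : ℝ) (k : ℕ) (ξ : (Fin k → ℝ) × (Fin k → ℝ)) : ℝ :=
  ∏ j, jap (ξ.1 j) ^ ε * jap (ξ.2 j) ^ ε

lemma wt_pos (ε : ℝ) (k : ℕ) (ξ : (Fin k → ℝ) × (Fin k → ℝ)) : 0 < wt ε k ξ :=
  Finset.prod_pos fun _ _ => mul_pos (Real.rpow_pos_of_pos (jap_pos _) _)
    (Real.rpow_pos_of_pos (jap_pos _) _)

lemma continuous_wt (ε : ℝ) (k : ℕ) : Continuous (wt ε k) := by
  have := continuous_jap_rpow ε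
  exact continuous_finsetProd _ fun j _ =>
    (this.comp (f := fun ξ : (Fin k → ℝ) × (Fin k → ℝ) => ξ.1 j) (by fun_prop)).mul
      (this.comp (f := fun ξ : (Fin k → ℝ) × (Fin k → ℝ) => ξ.2 j) (by fun_prop))

lemma hasTemperateGrowth_jap_rpow (ε : ℝ) : (fun x : ℝ => jap x ^ ε).HasTemperateGrowth := by
  simp only [jap_rpow_eq]
  exact Function.hasTemperateGrowth_one_add_norm_sq_rpow ℝ _

lemma Function.HasTemperateGrowth.finsetProd {E ι : Type*} [NormedAddCommGroup E] [NormedSpace ℝ E]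
    (s : Finset ι) {f : ι → E → ℝ} (hf : ∀ i, (f i).HasTemperateGrowth) :
    (fun x => ∏ i ∈ s, f i x).HasTemperateGrowth := by
  classical
  induction s using Finset.induction_on with
  | empty => simp [Function.HasTemperateGrowth.const]
  | insert a s ha ih =>
    simp only [Finset.prod_insert ha]
    exact (hf a).mul ih

lemma hasTemperateGrowth_wt (ε : ℝ) (k : ℕ) : (wt ε k).HasTemperateGrowth := by
  refine Function.HasTemperateGrowth.finsetProd _ fun j => ?_
  exact ((hasTemperateGrowth_jap_rpow ε).comp
      ((ContinuousLinearMap.proj j).comp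
        (ContinuousLinearMap.fst ℝ (Fin k → ℝ) (Fin k → ℝ))).hasTemperateGrowth).mul
    ((hasTemperateGrowth_jap_rpow ε).comp
      ((ContinuousLinearMap.proj j).comp
        (ContinuousLinearMap.snd ℝ (Fin k → ℝ) (Fin k → ℝ))).hasTemperateGrowth)

/-- The `L²` norm of `R_ε φ` on the Fourier side. -/
lemma lintegral_enorm_Rop_schwartz_sq (ε : ℝ) (k : ℕ)
    (φ : SchwartzMap ((Fin k → ℝ) × (Fin k → ℝ)) ℂ) :
    ∫⁻ y, ‖Rop ε k φ y‖ₑ ^ 2 = ENNReal.ofReal (((2 * Real.pi) ^ (2 * k))⁻¹) *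
      ∫⁻ ξ, ENNReal.ofReal (wt ε k ξ ^ 2) * ‖ftSchwartz k φ ξ‖ₑ ^ 2 := by
  set ψ := SchwartzMap.smulLeftCLM ℂ (wt ε k) (ftSchwartz k φ)
  have hψ : ⇑ψ = fun ξ => ((wt ε k ξ : ℝ) : ℂ) * ftK k φ ξ := by
    rw [SchwartzMap.smulLeftCLM_apply (hasTemperateGrowth_wt ε k), coe_ftSchwartz]
    simp
  have h1 : Rop ε k φ = invK k ψ := by rw [hψ]; rfl
  rw [h1, lintegral_enorm_invK_sq ψ.integrable (ψ.memLp 2), hψ, coe_ftSchwartz]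
  congr 1
  refine lintegral_congr fun ξ => ?_
  rw [enorm_mul, mul_pow, ← ofReal_norm, norm_real, Real.norm_of_nonneg (wt_pos ε k ξ).le,
    ENNReal.ofReal_pow (wt_pos ε k ξ).le]

/-- The `L²` norm of `R_ε f` is controlled on the Fourier side when `f` is an inverse transform. -/
lemma lintegral_enorm_Rop_invK_sq_le (ε : ℝ) {k : ℕ} {h : (Fin k → ℝ) × (Fin k → ℝ) → ℂ}
    (hc : Continuous h) (hi : Integrable h) :
    ∫⁻ y, ‖Rop ε k (invK k h) y‖ₑ ^ 2 ≤ ENNReal.ofReal (((2 * Real.pi) ^ (2 * k))⁻¹) *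
      ∫⁻ ξ, ENNReal.ofReal (wt ε k ξ ^ 2) * ‖h ξ‖ₑ ^ 2 := by
  refine (lintegral_enorm_invK_sq_le (fun ξ => ((wt ε k ξ : ℝ) : ℂ) * ftK k (invK k h) ξ)).trans ?_
  gcongr with ξ
  rw [enorm_mul, mul_pow, ← ofReal_norm, norm_real, Real.norm_of_nonneg (wt_pos ε k ξ).le,
    ENNReal.ofReal_pow (wt_pos ε k ξ).le]
  gcongr
  rw [← ofReal_norm, ← ofReal_norm]
  exact ENNReal.ofReal_le_ofReal (norm_ftK_invK_le hc hi ξ)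

section Lift

/-- The change of variables isolating the two momenta absorbed by the collision. -/
def collisionLift {k : ℕ} (s : ℝ × ℝ → (Fin k → ℝ) × (Fin k → ℝ))
    (q : ((Fin k → ℝ) × (Fin k → ℝ)) × (ℝ × ℝ)) : (Fin (k + 1) → ℝ) × (Fin (k + 1) → ℝ) :=
  (Fin.snoc (q.1 - s q.2).1 q.2.1, Fin.snoc (q.1 - s q.2).2 q.2.2)

lemma measurePreserving_snoc (k : ℕ) :
    MeasurePreserving (fun p : (Fin k → ℝ) × ℝ => (Fin.snoc p.1 p.2 : Fin (k + 1) → ℝ)) := by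
  have h := ((volume_preserving_piFinSuccAbove (fun _ : Fin (k + 1) => ℝ) (Fin.last k)).symm _).comp
    (Measure.measurePreserving_swap (μ := (volume : Measure (Fin k → ℝ)))
      (ν := (volume : Measure ℝ)))
  have e : (fun p : (Fin k → ℝ) × ℝ => (Fin.snoc p.1 p.2 : Fin (k + 1) → ℝ)) =
      (MeasurableEquiv.piFinSuccAbove (fun _ : Fin (k + 1) => ℝ) (Fin.last k)).symm ∘ Prod.swap :=
    funext fun p => (Fin.insertNth_last' p.2 p.1).symm
  rw [e]
  exact h

lemma measurePreserving_prodProdProdComm {α β γ δ : Type*} [MeasureSpace α] [MeasureSpace β]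
    [MeasureSpace γ] [MeasureSpace δ] [SFinite (volume : Measure α)] [SFinite (volume : Measure β)]
    [SFinite (volume : Measure γ)] [SFinite (volume : Measure δ)] :
    MeasurePreserving (fun p : (α × β) × (γ × δ) => ((p.1.1, p.2.1), (p.1.2, p.2.2))) := by
  have h1 : MeasurePreserving (fun p : β × (γ × δ) => (p.2.1, (p.1, p.2.2))) :=
    (measurePreserving_prodAssoc volume volume volume).comp
      ((Measure.measurePreserving_swap.prod (MeasurePreserving.id volume)).comp
        ((measurePreserving_prodAssoc volume volume volume).symm _))
  exact ((measurePreserving_prodAssoc volume volume volume).symm _).comp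
    (((MeasurePreserving.id volume).prod h1).comp
      (measurePreserving_prodAssoc volume volume volume))

lemma continuous_collisionLift {k : ℕ} {s : ℝ × ℝ → (Fin k → ℝ) × (Fin k → ℝ)} (hs : Continuous s) :
    Continuous (collisionLift s) :=
  (Continuous.finSnoc (by fun_prop) (by fun_prop)).prodMk
    (Continuous.finSnoc (by fun_prop) (by fun_prop))

lemma measurePreserving_collisionLift {k : ℕ} {s : ℝ × ℝ → (Fin k → ℝ) × (Fin k → ℝ)}
    (hs : Continuous s) :
    MeasurePreserving (collisionLift s) := by
  have h1 : MeasurePreserving (fun q : (ℝ × ℝ) × ((Fin k → ℝ) × (Fin k → ℝ)) =>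
      (q.1, q.2 - s q.1)) :=
    (MeasurePreserving.id volume).skew_product (g := fun z ξ => ξ - s z) (by fun_prop)
      (Filter.Eventually.of_forall fun z => (measurePreserving_sub_right volume (s z)).map_eq)
  have h2 : MeasurePreserving (fun q : ((Fin k → ℝ) × (Fin k → ℝ)) × (ℝ × ℝ) =>
      (q.1 - s q.2, q.2)) :=
    Measure.measurePreserving_swap.comp (h1.comp Measure.measurePreserving_swap)
  exact ((measurePreserving_snoc k).prod (measurePreserving_snoc k)).comp
    (measurePreserving_prodProdProdComm.comp h2)

lemma norm_le_norm_collisionLift {k : ℕ} (s : ℝ × ℝ → (Fin k → ℝ) × (Fin k → ℝ))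
    (q : ((Fin k → ℝ) × (Fin k → ℝ)) × (ℝ × ℝ)) : ‖q.2‖ ≤ ‖collisionLift s q‖ := by
  refine max_le ?_ ?_
  · refine le_trans ?_ (norm_fst_le (collisionLift s q))
    simpa [collisionLift] using norm_le_pi_norm (collisionLift s q).1 (Fin.last k)
  · refine le_trans ?_ (norm_snd_le (collisionLift s q))
    simpa [collisionLift] using norm_le_pi_norm (collisionLift s q).2 (Fin.last k)

lemma exists_integrable_bound_comp_collisionLift {k : ℕ}
    (Φ : SchwartzMap ((Fin (k + 1) → ℝ) × (Fin (k + 1) → ℝ)) ℂ) :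
    ∃ G : ℝ × ℝ → ℝ, Integrable G ∧ ∀ (s : ℝ × ℝ → (Fin k → ℝ) × (Fin k → ℝ)) ξ z,
      ‖Φ (collisionLift s (ξ, z))‖ ≤ G z := by
  have h1 := fun x => SchwartzMap.one_add_le_sup_seminorm_apply (𝕜 := ℝ) (m := (3, 0)) (k := 3)
    (n := 0) le_rfl le_rfl Φ x
  simp only [norm_iteratedFDeriv_zero] at h1
  set C := 2 ^ 3 * (Finset.Iic (3, 0)).sup (fun m => SchwartzMap.seminorm ℝ m.1 m.2) Φ with hC
  refine ⟨fun z => C * (1 + ‖z‖) ^ (-3 : ℝ),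
    (integrable_one_add_norm (by simp; norm_num)).const_mul _,
    fun s ξ z => ?_⟩
  have h2 := norm_le_norm_collisionLift s (ξ, z)
  simp only at h2
  beta_reduce
  rw [Real.rpow_neg (by positivity), ← div_eq_mul_inv, le_div_iff₀ (by positivity)]
  refine le_trans ?_ (h1 (collisionLift s (ξ, z)))
  rw [mul_comm]
  norm_cast
  gcongr

end Lift

section Amplitude

/-- The kinetic phase `|ξ|² - |ξ'|²`. -/
def kin {n : ℕ} (ξ : (Fin n → ℝ) × (Fin n → ℝ)) : ℝ := (∑ i, ξ.1 i ^ 2) - ∑ i, ξ.2 i ^ 2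

lemma continuous_kin (n : ℕ) : Continuous (kin (n := n)) := by
  unfold kin; fun_prop

variable {k : ℕ} (s : ℝ × ℝ → (Fin k → ℝ) × (Fin k → ℝ))
  (Φ : SchwartzMap ((Fin (k + 1) → ℝ) × (Fin (k + 1) → ℝ)) ℂ)

/-- The Fourier transform of half of the collision term at time `τ`, up to normalisation. -/
def collisionAmp (τ : ℝ) (ξ : (Fin k → ℝ) × (Fin k → ℝ)) : ℂ :=
  oscInt volume (fun z => kin (collisionLift s (ξ, z))) (fun z => Φ (collisionLift s (ξ, z))) τ

variable {s}

lemma integrable_comp_collisionLift (hs : Continuous s) (ξ : (Fin k → ℝ) × (Fin k → ℝ)) :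
    Integrable fun z => Φ (collisionLift s (ξ, z)) := by
  obtain ⟨G, hG, hb⟩ := exists_integrable_bound_comp_collisionLift Φ
  refine hG.mono' (Continuous.aestronglyMeasurable ?_) (Filter.Eventually.of_forall (hb s ξ))
  exact Φ.continuous.comp ((continuous_collisionLift hs).comp (by fun_prop))

lemma norm_cexp_neg_I_mul (x : ℝ) : ‖cexp (-(I * (x : ℂ)))‖ = 1 := by
  rw [← mul_neg, ← ofReal_neg, mul_comm, Complex.norm_exp_ofReal_mul_I]

lemma continuous_collisionAmp (hs : Continuous s) :
    Continuous fun p : ℝ × ((Fin k → ℝ) × (Fin k → ℝ)) => collisionAmp s Φ p.1 p.2 := by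
  obtain ⟨G, hG, hb⟩ := exists_integrable_bound_comp_collisionLift Φ
  have h1 := continuous_collisionLift hs
  have h2 := continuous_kin (k + 1)
  have h3 := Φ.continuous
  have hc : Continuous fun r : (ℝ × ((Fin k → ℝ) × (Fin k → ℝ))) × (ℝ × ℝ) =>
      cexp (-(I * ((r.1.1 * kin (collisionLift s (r.1.2, r.2)) : ℝ) : ℂ))) *
        Φ (collisionLift s (r.1.2, r.2)) := by fun_prop
  refine continuous_of_dominated (bound := G) (fun p => Continuous.aestronglyMeasurable
    (hc.comp (by fun_prop : Continuous fun z => (p, z))))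
    (fun p => Filter.Eventually.of_forall fun z => ?_) hG
    (Filter.Eventually.of_forall fun z => hc.comp (by fun_prop : Continuous fun p => (p, z)))
  rw [norm_mul, norm_cexp_neg_I_mul, one_mul]
  exact hb s p.2 z

lemma integrable_phase_mul_comp_collisionLift (hs : Continuous s) (τ : ℝ) :
    Integrable fun q : ((Fin k → ℝ) × (Fin k → ℝ)) × (ℝ × ℝ) =>
      cexp (-(I * ((τ * kin (collisionLift s q) : ℝ) : ℂ))) * Φ (collisionLift s q) := by
  have h1 := continuous_collisionLift hs
  have h2 := continuous_kin (k + 1)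
  refine ((measurePreserving_collisionLift hs).integrable_comp_of_integrable Φ.integrable).bdd_mul
    (c := 1) (Continuous.aestronglyMeasurable (by fun_prop))
    (Filter.Eventually.of_forall fun q => (norm_cexp_neg_I_mul _).le)

lemma integrable_collisionAmp (hs : Continuous s) (τ : ℝ) : Integrable (collisionAmp s Φ τ) :=
  (integrable_phase_mul_comp_collisionLift Φ hs τ).integral_prod_left

lemma integrable_cexp_dotR_mul {n : ℕ} {g : (Fin n → ℝ) × (Fin n → ℝ) → ℂ} (hg : Integrable g)
    (y : (Fin n → ℝ) × (Fin n → ℝ)) : Integrable fun ξ : (Fin n → ℝ) × (Fin n → ℝ) =>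
      cexp (I * ((dotR y.1 ξ.1 + dotR y.2 ξ.2 : ℝ) : ℂ)) * g ξ := by
  refine hg.bdd_mul (c := 1) (Continuous.aestronglyMeasurable (by unfold dotR; fun_prop))
    (Filter.Eventually.of_forall fun q => ?_)
  rw [mul_comm, Complex.norm_exp_ofReal_mul_I]

lemma freeEvol_eq_invK_collisionAmp (hs : Continuous s) (τ : ℝ)
    (φ : SchwartzMap ((Fin (k + 1) → ℝ) × (Fin (k + 1) → ℝ)) ℂ)
    (Y : (Fin (k + 1) → ℝ) × (Fin (k + 1) → ℝ)) (y : (Fin k → ℝ) × (Fin k → ℝ))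
    (hY : ∀ q, dotR Y.1 (collisionLift s q).1 + dotR Y.2 (collisionLift s q).2 =
      dotR y.1 q.1.1 + dotR y.2 q.1.2) :
    freeEvol (k + 1) τ φ Y = (((2 * Real.pi) ^ 2)⁻¹ : ℝ) •
      invK k (collisionAmp s (ftSchwartz (k + 1) φ) τ) y := by
  have h2 := continuous_kin (k + 1)
  have hF : Continuous fun ζ : (Fin (k + 1) → ℝ) × (Fin (k + 1) → ℝ) =>
      cexp (I * ((dotR Y.1 ζ.1 + dotR Y.2 ζ.2 - τ * kin ζ : ℝ) : ℂ)) *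
        ftSchwartz (k + 1) φ ζ := by
    have := (ftSchwartz (k + 1) φ).continuous
    unfold dotR; fun_prop
  have hmp := measurePreserving_collisionLift hs
  have e1 : freeEvol (k + 1) τ φ Y = (((2 * Real.pi) ^ (2 * (k + 1)))⁻¹ : ℝ) •
      ∫ ζ, cexp (I * ((dotR Y.1 ζ.1 + dotR Y.2 ζ.2 - τ * kin ζ : ℝ) : ℂ)) *
        ftSchwartz (k + 1) φ ζ := by
    rw [coe_ftSchwartz]; rfl
  have hpt (q : ((Fin k → ℝ) × (Fin k → ℝ)) × (ℝ × ℝ)) :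
      cexp (I * ((dotR Y.1 (collisionLift s q).1 + dotR Y.2 (collisionLift s q).2 -
        τ * kin (collisionLift s q) : ℝ) : ℂ)) * ftSchwartz (k + 1) φ (collisionLift s q) =
      cexp (I * ((dotR y.1 q.1.1 + dotR y.2 q.1.2 : ℝ) : ℂ)) *
        (cexp (-(I * ((τ * kin (collisionLift s q) : ℝ) : ℂ))) *
          ftSchwartz (k + 1) φ (collisionLift s q)) := by
    rw [hY, ← mul_assoc, ← Complex.exp_add]
    congr 2; push_cast; ring
  have hint : Integrable fun q : ((Fin k → ℝ) × (Fin k → ℝ)) × (ℝ × ℝ) =>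
      cexp (I * ((dotR y.1 q.1.1 + dotR y.2 q.1.2 : ℝ) : ℂ)) *
        (cexp (-(I * ((τ * kin (collisionLift s q) : ℝ) : ℂ))) *
          ftSchwartz (k + 1) φ (collisionLift s q)) := by
    refine (integrable_phase_mul_comp_collisionLift _ hs τ).bdd_mul (c := 1)
      (Continuous.aestronglyMeasurable (by unfold dotR; fun_prop))
      (Filter.Eventually.of_forall fun q => ?_)
    rw [mul_comm, Complex.norm_exp_ofReal_mul_I]
  rw [e1, ← hmp.map_eq, integral_map hmp.measurable.aemeasurable hF.aestronglyMeasurable]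
  simp only [hpt]
  rw [Measure.volume_eq_prod, integral_prod _ hint, invK, smul_smul, mul_add, mul_one, pow_add,
    mul_inv, mul_comm]
  simp only [integral_const_mul]
  rfl

/-- The space-time estimate for the collision amplitude, from a uniform level-set bound. -/
lemma lintegral_lintegral_wt_mul_collisionAmp_sq_le (hs : Continuous s) {T : ℝ} (hT : 0 < T)
    (ε : ℝ) {ω : (Fin k → ℝ) × (Fin k → ℝ) → ℝ × ℝ → ℝ} (hωm : ∀ ξ, Measurable (ω ξ))
    (hω : ∀ ξ z, 0 < ω ξ z)
    (hwt : ∀ ξ z, wt ε (k + 1) (collisionLift s (ξ, z)) ^ 2 = wt ε k ξ ^ 2 * ω ξ z)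
    {M : ℝ≥0∞} (hM : ∀ ξ r, ∫⁻ z, ENNReal.ofReal
      ((1 + (kin (collisionLift s (ξ, z)) - r) ^ 2)⁻¹ * (ω ξ z)⁻¹) ≤ M) :
    ∫⁻ τ in Set.Ioc 0 T, ∫⁻ ξ, ENNReal.ofReal (wt ε k ξ ^ 2) * ‖collisionAmp s Φ τ ξ‖ₑ ^ 2 ≤
      ENNReal.ofReal (2 * Real.exp 1 * (√(Real.pi * T ^ 2) * (1 + 4 / T ^ 2))) * M *
        ∫⁻ ζ, ENNReal.ofReal (wt ε (k + 1) ζ ^ 2) * ‖Φ ζ‖ₑ ^ 2 := by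
  have hc := continuous_collisionAmp Φ hs
  have hwc := continuous_wt ε k
  have hwc' := continuous_wt ε (k + 1)
  have hl := continuous_collisionLift hs
  have hΦ := Φ.continuous
  have hcm : Measurable fun p : ℝ × ((Fin k → ℝ) × (Fin k → ℝ)) =>
      ENNReal.ofReal (wt ε k p.2 ^ 2) * ‖collisionAmp s Φ p.1 p.2‖ₑ ^ 2 := by
    have := hc.measurable
    have := hwc.measurable
    fun_prop
  set K := ENNReal.ofReal (2 * Real.exp 1 * (√(Real.pi * T ^ 2) * (1 + 4 / T ^ 2))) with hK
  rw [lintegral_lintegral_swap hcm.aemeasurable]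
  have hmΨ : Measurable fun ζ => ENNReal.ofReal (wt ε (k + 1) ζ ^ 2) * ‖Φ ζ‖ₑ ^ 2 := by
    have := hwc'.measurable
    have := hΦ.measurable
    fun_prop
  have hmL := hmΨ.comp hl.measurable
  have hprod : ∫⁻ ζ, ENNReal.ofReal (wt ε (k + 1) ζ ^ 2) * ‖Φ ζ‖ₑ ^ 2 = ∫⁻ ξ, ∫⁻ z,
      ENNReal.ofReal (wt ε (k + 1) (collisionLift s (ξ, z)) ^ 2) *
        ‖Φ (collisionLift s (ξ, z))‖ₑ ^ 2 :=
    ((measurePreserving_collisionLift hs).lintegral_comp hmΨ).symm.trans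
      (lintegral_prod _ hmL.aemeasurable)
  have hmR : Measurable fun ξ => ∫⁻ z, ENNReal.ofReal
      (wt ε (k + 1) (collisionLift s (ξ, z)) ^ 2) * ‖Φ (collisionLift s (ξ, z))‖ₑ ^ 2 :=
    hmL.lintegral_prod_right'
  rw [hprod, ← lintegral_const_mul _ hmR]
  refine lintegral_mono fun ξ => ?_
  have hPm : Measurable fun z : ℝ × ℝ => kin (collisionLift s (ξ, z)) :=
    ((continuous_kin (k + 1)).comp (hl.comp (by fun_prop))).measurable
  have hgm : Measurable fun z : ℝ × ℝ => Φ (collisionLift s (ξ, z)) :=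
    (hΦ.comp (hl.comp (by fun_prop))).measurable
  have hξ := lintegral_Ioc_oscInt_sq_le volume hT hPm (integrable_comp_collisionLift Φ hs ξ) hgm
    (hωm ξ) (hω ξ) (hM ξ)
  rw [lintegral_const_mul' _ _ ENNReal.ofReal_ne_top]
  calc _ ≤ ENNReal.ofReal (wt ε k ξ ^ 2) * (K * M *
        ∫⁻ z, ENNReal.ofReal (ω ξ z) * ‖Φ (collisionLift s (ξ, z))‖ₑ ^ 2) := by
        gcongr
        exact hξ
    _ = K * M * ∫⁻ z, ENNReal.ofReal (wt ε k ξ ^ 2) *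
        (ENNReal.ofReal (ω ξ z) * ‖Φ (collisionLift s (ξ, z))‖ₑ ^ 2) := by
        rw [lintegral_const_mul' _ _ ENNReal.ofReal_ne_top, mul_left_comm]
    _ = _ := by
        congr 1
        refine lintegral_congr fun z => ?_
        rw [hwt, ENNReal.ofReal_mul (sq_nonneg _), mul_assoc]

end Amplitude

section Shifts

variable {k : ℕ}

/-- The momentum shift of the unprimed variable `j`. -/
def shiftFst (j : Fin k) (z : ℝ × ℝ) : (Fin k → ℝ) × (Fin k → ℝ) := (Pi.single j (z.1 + z.2), 0)

/-- The momentum shift of the primed variable `j`. -/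
def shiftSnd (j : Fin k) (z : ℝ × ℝ) : (Fin k → ℝ) × (Fin k → ℝ) := (0, Pi.single j (z.1 + z.2))

lemma continuous_pi_single (j : Fin k) :
    Continuous fun z : ℝ × ℝ => (Pi.single j (z.1 + z.2) : Fin k → ℝ) :=
  (continuous_single j).comp (by fun_prop)

lemma continuous_shiftFst (j : Fin k) : Continuous (shiftFst j) :=
  (continuous_pi_single j).prodMk continuous_const

lemma continuous_shiftSnd (j : Fin k) : Continuous (shiftSnd j) :=
  continuous_const.prodMk (continuous_pi_single j)

lemma sum_comp_sub_single (f : ℝ → ℝ) (x : Fin k → ℝ) (j : Fin k) (c : ℝ) :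
    ∑ i, f ((x - Pi.single j c : Fin k → ℝ) i) = f (x j - c) - f (x j) + ∑ i, f (x i) := by
  rw [← Finset.add_sum_erase _ _ (Finset.mem_univ j), ← Finset.add_sum_erase _ (fun i => f (x i))
    (Finset.mem_univ j)]
  have : ∑ i ∈ Finset.univ.erase j, f ((x - Pi.single j c : Fin k → ℝ) i) =
      ∑ i ∈ Finset.univ.erase j, f (x i) := Finset.sum_congr rfl fun i hi => by
    simp [Pi.single_eq_of_ne (Finset.ne_of_mem_erase hi)]
  rw [this]
  simp
  ring

lemma prod_comp_sub_single_mul (f : ℝ → ℝ) (x : Fin k → ℝ) (j : Fin k) (c : ℝ) :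
    (∏ i, f ((x - Pi.single j c : Fin k → ℝ) i)) * f (x j) = f (x j - c) * ∏ i, f (x i) := by
  rw [← Finset.mul_prod_erase _ _ (Finset.mem_univ j), ← Finset.mul_prod_erase _ (fun i => f (x i))
    (Finset.mem_univ j)]
  have : ∏ i ∈ Finset.univ.erase j, f ((x - Pi.single j c : Fin k → ℝ) i) =
      ∏ i ∈ Finset.univ.erase j, f (x i) := Finset.prod_congr rfl fun i hi => by
    simp [Pi.single_eq_of_ne (Finset.ne_of_mem_erase hi)]
  rw [this]
  simp
  ring

lemma dotR_snoc (a b : Fin k → ℝ) (x y : ℝ) :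
    dotR (Fin.snoc a x : Fin (k + 1) → ℝ) (Fin.snoc b y) = dotR a b + x * y := by
  simp [dotR, Fin.sum_univ_castSucc]

lemma dotR_sub_single (a b : Fin k → ℝ) (j : Fin k) (c : ℝ) :
    dotR a (b - Pi.single j c) = dotR a b - a j * c := by
  simp [dotR, mul_sub, Finset.sum_sub_distrib, Pi.single_apply]

lemma kin_snoc (a b : Fin k → ℝ) (x y : ℝ) :
    kin ((Fin.snoc a x, Fin.snoc b y) : (Fin (k + 1) → ℝ) × (Fin (k + 1) → ℝ)) =
      ((∑ i, a i ^ 2) + x ^ 2) - ((∑ i, b i ^ 2) + y ^ 2) := by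
  simp [kin, Fin.sum_univ_castSucc]

lemma wt_snoc (ε : ℝ) (a b : Fin k → ℝ) (x y : ℝ) :
    wt ε (k + 1) (Fin.snoc a x, Fin.snoc b y) =
      ((∏ i, jap (a i) ^ ε) * ∏ i, jap (b i) ^ ε) * (jap x ^ ε * jap y ^ ε) := by
  simp [wt, Fin.prod_univ_castSucc, Finset.prod_mul_distrib]
  ring

lemma wt_eq_mul (ε : ℝ) (ξ : (Fin k → ℝ) × (Fin k → ℝ)) :
    wt ε k ξ = (∏ i, jap (ξ.1 i) ^ ε) * ∏ i, jap (ξ.2 i) ^ ε :=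
  Finset.prod_mul_distrib

lemma wt_collisionLift_shiftFst (ε : ℝ) (j : Fin k) (ξ : (Fin k → ℝ) × (Fin k → ℝ)) (z : ℝ × ℝ) :
    wt ε (k + 1) (collisionLift (shiftFst j) (ξ, z)) ^ 2 =
      wt ε k ξ ^ 2 * japRatio ε (ξ.1 j) z.1 z.2 := by
  have h := prod_comp_sub_single_mul (fun x => jap x ^ ε) ξ.1 j (z.1 + z.2)
  have hp : 0 < jap (ξ.1 j) ^ ε := Real.rpow_pos_of_pos (jap_pos _) _
  rw [← eq_div_iff hp.ne'] at h
  simp only [collisionLift, shiftFst, Prod.fst_sub, Prod.snd_sub, sub_zero]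
  rw [wt_snoc, wt_eq_mul, h, japRatio, ← mul_pow, sub_add_eq_sub_sub]
  congr 1
  field_simp

lemma wt_collisionLift_shiftSnd (ε : ℝ) (j : Fin k) (ξ : (Fin k → ℝ) × (Fin k → ℝ)) (z : ℝ × ℝ) :
    wt ε (k + 1) (collisionLift (shiftSnd j) (ξ, z)) ^ 2 =
      wt ε k ξ ^ 2 * japRatio ε (ξ.2 j) z.2 z.1 := by
  have h := prod_comp_sub_single_mul (fun x => jap x ^ ε) ξ.2 j (z.1 + z.2)
  have hp : 0 < jap (ξ.2 j) ^ ε := Real.rpow_pos_of_pos (jap_pos _) _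
  rw [← eq_div_iff hp.ne'] at h
  simp only [collisionLift, shiftSnd, Prod.fst_sub, Prod.snd_sub, sub_zero]
  rw [wt_snoc, wt_eq_mul, h, japRatio, ← mul_pow, add_comm z.1, sub_add_eq_sub_sub]
  congr 1
  field_simp

lemma kin_collisionLift_shiftFst (j : Fin k) (ξ : (Fin k → ℝ) × (Fin k → ℝ)) (z : ℝ × ℝ) :
    kin (collisionLift (shiftFst j) (ξ, z)) =
      (ξ.1 j - z.1 - z.2) ^ 2 + z.1 ^ 2 - z.2 ^ 2 + (kin ξ - ξ.1 j ^ 2) := by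
  simp only [collisionLift, shiftFst, Prod.fst_sub, Prod.snd_sub, sub_zero]
  rw [kin_snoc, sum_comp_sub_single (fun x => x ^ 2), kin]
  ring

lemma kin_collisionLift_shiftSnd (j : Fin k) (ξ : (Fin k → ℝ) × (Fin k → ℝ)) (z : ℝ × ℝ) :
    kin (collisionLift (shiftSnd j) (ξ, z)) =
      -((ξ.2 j - z.2 - z.1) ^ 2 + z.2 ^ 2 - z.1 ^ 2 - (kin ξ + ξ.2 j ^ 2)) := by
  simp only [collisionLift, shiftSnd, Prod.fst_sub, Prod.snd_sub, sub_zero]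
  rw [kin_snoc, sum_comp_sub_single (fun x => x ^ 2), kin]
  ring

lemma collision_freeEvol (j : Fin k) (τ : ℝ)
    (φ : SchwartzMap ((Fin (k + 1) → ℝ) × (Fin (k + 1) → ℝ)) ℂ) :
    collision k j (fun y => freeEvol (k + 1) τ φ y) =
      invK k fun ξ => (((2 * Real.pi) ^ 2)⁻¹ : ℝ) •
        (collisionAmp (shiftFst j) (ftSchwartz (k + 1) φ) τ ξ -
          collisionAmp (shiftSnd j) (ftSchwartz (k + 1) φ) τ ξ) := by
  ext y
  rw [collision, freeEvol_eq_invK_collisionAmp (continuous_shiftFst j) τ φ _ y,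
    freeEvol_eq_invK_collisionAmp (continuous_shiftSnd j) τ φ _ y]
  · have h1 := integrable_cexp_dotR_mul (integrable_collisionAmp (ftSchwartz (k + 1) φ)
      (continuous_shiftFst j) τ) y
    have h2 := integrable_cexp_dotR_mul (integrable_collisionAmp (ftSchwartz (k + 1) φ)
      (continuous_shiftSnd j) τ) y
    simp only [invK, mul_smul_comm, mul_sub]
    rw [integral_smul, integral_sub h1 h2]
    simp only [Complex.real_smul]
    ring
  · intro q
    simp only [collisionLift, shiftSnd, Prod.fst_sub, Prod.snd_sub, sub_zero]
    rw [dotR_snoc, dotR_snoc, dotR_sub_single]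
    ring
  · intro q
    simp only [collisionLift, shiftFst, Prod.fst_sub, Prod.snd_sub, sub_zero]
    rw [dotR_snoc, dotR_snoc, dotR_sub_single]
    ring

lemma L2E_sq (f : (Fin k → ℝ) × (Fin k → ℝ) → ℂ) : L2E k f ^ 2 = ∫⁻ y, ‖f y‖ₑ ^ 2 := by
  rw [L2E, ← ENNReal.rpow_two, ← ENNReal.rpow_mul]
  norm_num
  rfl

end Shifts

lemma lintegral_kernel_shiftFst_le {ε : ℝ} {M : ℝ≥0∞}
    (hM : ∀ x s : ℝ, ∫⁻ z : ℝ × ℝ, ENNReal.ofReal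
      ((1 + ((x - z.1 - z.2) ^ 2 + z.1 ^ 2 - z.2 ^ 2 - s) ^ 2)⁻¹ * (japRatio ε x z.1 z.2)⁻¹) ≤ M)
    {k : ℕ} (j : Fin k) (ξ : (Fin k → ℝ) × (Fin k → ℝ)) (r : ℝ) :
    ∫⁻ z : ℝ × ℝ, ENNReal.ofReal ((1 + (kin (collisionLift (shiftFst j) (ξ, z)) - r) ^ 2)⁻¹ *
      (japRatio ε (ξ.1 j) z.1 z.2)⁻¹) ≤ M := by
  refine le_trans (le_of_eq ?_) (hM (ξ.1 j) (r - (kin ξ - ξ.1 j ^ 2)))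
  refine lintegral_congr fun z => ?_
  rw [kin_collisionLift_shiftFst]
  congr 4
  ring

lemma lintegral_kernel_shiftSnd_le {ε : ℝ} {M : ℝ≥0∞}
    (hM : ∀ x s : ℝ, ∫⁻ z : ℝ × ℝ, ENNReal.ofReal
      ((1 + ((x - z.1 - z.2) ^ 2 + z.1 ^ 2 - z.2 ^ 2 - s) ^ 2)⁻¹ * (japRatio ε x z.1 z.2)⁻¹) ≤ M)
    {k : ℕ} (j : Fin k) (ξ : (Fin k → ℝ) × (Fin k → ℝ)) (r : ℝ) :
    ∫⁻ z : ℝ × ℝ, ENNReal.ofReal ((1 + (kin (collisionLift (shiftSnd j) (ξ, z)) - r) ^ 2)⁻¹ *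
      (japRatio ε (ξ.2 j) z.2 z.1)⁻¹) ≤ M := by
  refine le_trans (le_of_eq ?_) (hM (ξ.2 j) (kin ξ + ξ.2 j ^ 2 - r))
  refine Eq.trans ?_ ((Measure.measurePreserving_swap (μ := (volume : Measure ℝ))
    (ν := (volume : Measure ℝ))).lintegral_comp_emb MeasurableEquiv.prodComm.measurableEmbedding _)
  refine lintegral_congr fun z => ?_
  rw [kin_collisionLift_shiftSnd, Prod.fst_swap, Prod.snd_swap]
  congr 3
  ring

lemma enorm_smul_sub_sq_le (d : ℝ) (a b : ℂ) :
    ‖d • (a - b)‖ₑ ^ 2 ≤ ENNReal.ofReal (2 * d ^ 2) * (‖a‖ₑ ^ 2 + ‖b‖ₑ ^ 2) := by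
  have h : ‖d • (a - b)‖ ^ 2 ≤ 2 * d ^ 2 * (‖a‖ ^ 2 + ‖b‖ ^ 2) := by
    rw [norm_smul, mul_pow, Real.norm_eq_abs, sq_abs]
    have : ‖a - b‖ ^ 2 ≤ 2 * (‖a‖ ^ 2 + ‖b‖ ^ 2) :=
      (pow_le_pow_left₀ (norm_nonneg _) (norm_sub_le a b) 2).trans (add_sq_le)
    nlinarith [mul_le_mul_of_nonneg_left this (sq_nonneg d)]
  simp only [← ofReal_norm]
  rw [← ENNReal.ofReal_pow (norm_nonneg _), ← ENNReal.ofReal_pow (norm_nonneg _),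
    ← ENNReal.ofReal_pow (norm_nonneg _), ← ENNReal.ofReal_add (by positivity) (by positivity),
    ← ENNReal.ofReal_mul (by positivity)]
  exact ENNReal.ofReal_le_ofReal h

section Assembly

variable {k : ℕ}

lemma continuous_collisionAmp_right (Φ : SchwartzMap ((Fin (k + 1) → ℝ) × (Fin (k + 1) → ℝ)) ℂ)
    {s : ℝ × ℝ → (Fin k → ℝ) × (Fin k → ℝ)} (hs : Continuous s) (τ : ℝ) :
    Continuous fun ξ => collisionAmp s Φ τ ξ :=
  Continuous.uncurry_left (f := collisionAmp s Φ) τ (continuous_collisionAmp Φ hs)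

lemma L2E_Rop_collision_sq_le (ε : ℝ) (j : Fin k) (τ : ℝ)
    (φ : SchwartzMap ((Fin (k + 1) → ℝ) × (Fin (k + 1) → ℝ)) ℂ) :
    L2E k (Rop ε k (collision k j (fun y => freeEvol (k + 1) τ φ y))) ^ 2 ≤
      ENNReal.ofReal (((2 * Real.pi) ^ (2 * k))⁻¹) *
        (ENNReal.ofReal (2 * (((2 * Real.pi) ^ 2)⁻¹) ^ 2) *
          ((∫⁻ ξ, ENNReal.ofReal (wt ε k ξ ^ 2) *
              ‖collisionAmp (shiftFst j) (ftSchwartz (k + 1) φ) τ ξ‖ₑ ^ 2) +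
            ∫⁻ ξ, ENNReal.ofReal (wt ε k ξ ^ 2) *
              ‖collisionAmp (shiftSnd j) (ftSchwartz (k + 1) φ) τ ξ‖ₑ ^ 2)) := by
  have hw := continuous_wt ε k
  rw [collision_freeEvol, L2E_sq]
  generalize ftSchwartz (k + 1) φ = Φ
  have hc₁ := continuous_collisionAmp_right Φ (continuous_shiftFst j) τ
  have hc₂ := continuous_collisionAmp_right Φ (continuous_shiftSnd j) τ
  refine (lintegral_enorm_Rop_invK_sq_le ε (h := fun ξ => (((2 * Real.pi) ^ 2)⁻¹ : ℝ) •
    (collisionAmp (shiftFst j) Φ τ ξ - collisionAmp (shiftSnd j) Φ τ ξ)) (by fun_prop)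
    (Integrable.smul (((2 * Real.pi) ^ 2)⁻¹ : ℝ) (f := fun ξ =>
      collisionAmp (shiftFst j) Φ τ ξ - collisionAmp (shiftSnd j) Φ τ ξ)
      ((integrable_collisionAmp Φ (continuous_shiftFst j) τ).sub
        (integrable_collisionAmp Φ (continuous_shiftSnd j) τ)))).trans ?_
  gcongr
  rw [← lintegral_add_left (by fun_prop), ← lintegral_const_mul _ (by fun_prop)]
  refine lintegral_mono fun ξ => ?_
  rw [← mul_add, mul_left_comm]
  gcongr
  exact enorm_smul_sub_sq_le _ _ _

lemma measurable_lintegral_wt_mul_collisionAmp_sq (ε : ℝ)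
    (Φ : SchwartzMap ((Fin (k + 1) → ℝ) × (Fin (k + 1) → ℝ)) ℂ)
    {s : ℝ × ℝ → (Fin k → ℝ) × (Fin k → ℝ)} (hs : Continuous s) :
    Measurable fun τ => ∫⁻ ξ, ENNReal.ofReal (wt ε k ξ ^ 2) * ‖collisionAmp s Φ τ ξ‖ₑ ^ 2 := by
  have hw := (continuous_wt ε k).comp (continuous_snd (X := ℝ))
  have hc := continuous_collisionAmp Φ hs
  refine Measurable.lintegral_prod_right' (f := fun p : ℝ × ((Fin k → ℝ) × (Fin k → ℝ)) =>
    ENNReal.ofReal (wt ε k p.2 ^ 2) * ‖collisionAmp s Φ p.1 p.2‖ₑ ^ 2) ?_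
  exact ((ENNReal.continuous_ofReal.comp (hw.pow 2)).measurable).mul
    (hc.measurable.enorm.pow_const 2)

lemma lintegral_wt_mul_collisionAmp_shiftFst_sq_le  {T ε : ℝ} {M : ℝ≥0∞} (hT : 0 < T)
    (hM : ∀ x s : ℝ, ∫⁻ z : ℝ × ℝ, ENNReal.ofReal
      ((1 + ((x - z.1 - z.2) ^ 2 + z.1 ^ 2 - z.2 ^ 2 - s) ^ 2)⁻¹ * (japRatio ε x z.1 z.2)⁻¹) ≤ M)
    (j : Fin k) (Φ : SchwartzMap ((Fin (k + 1) → ℝ) × (Fin (k + 1) → ℝ)) ℂ) :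
    ∫⁻ τ in Set.Ioc 0 T, ∫⁻ ξ, ENNReal.ofReal (wt ε k ξ ^ 2) *
        ‖collisionAmp (shiftFst j) Φ τ ξ‖ₑ ^ 2 ≤
      ENNReal.ofReal (2 * Real.exp 1 * (√(Real.pi * T ^ 2) * (1 + 4 / T ^ 2))) * M *
        ∫⁻ ζ, ENNReal.ofReal (wt ε (k + 1) ζ ^ 2) * ‖Φ ζ‖ₑ ^ 2 := by
  have hm : ∀ ξ : (Fin k → ℝ) × (Fin k → ℝ),
      Measurable fun z : ℝ × ℝ => japRatio ε (ξ.1 j) z.1 z.2 :=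
    fun ξ => (continuous_japRatio ε _).measurable
  exact lintegral_lintegral_wt_mul_collisionAmp_sq_le Φ (continuous_shiftFst j) hT ε hm
    (fun ξ z => japRatio_pos _ _ _ _) (wt_collisionLift_shiftFst ε j)
    (lintegral_kernel_shiftFst_le hM j)

lemma lintegral_wt_mul_collisionAmp_shiftSnd_sq_le  {T ε : ℝ} {M : ℝ≥0∞} (hT : 0 < T)
    (hM : ∀ x s : ℝ, ∫⁻ z : ℝ × ℝ, ENNReal.ofReal
      ((1 + ((x - z.1 - z.2) ^ 2 + z.1 ^ 2 - z.2 ^ 2 - s) ^ 2)⁻¹ * (japRatio ε x z.1 z.2)⁻¹) ≤ M)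
    (j : Fin k) (Φ : SchwartzMap ((Fin (k + 1) → ℝ) × (Fin (k + 1) → ℝ)) ℂ) :
    ∫⁻ τ in Set.Ioc 0 T, ∫⁻ ξ, ENNReal.ofReal (wt ε k ξ ^ 2) *
        ‖collisionAmp (shiftSnd j) Φ τ ξ‖ₑ ^ 2 ≤
      ENNReal.ofReal (2 * Real.exp 1 * (√(Real.pi * T ^ 2) * (1 + 4 / T ^ 2))) * M *
        ∫⁻ ζ, ENNReal.ofReal (wt ε (k + 1) ζ ^ 2) * ‖Φ ζ‖ₑ ^ 2 := by
  have hm : ∀ ξ : (Fin k → ℝ) × (Fin k → ℝ),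
      Measurable fun z : ℝ × ℝ => japRatio ε (ξ.2 j) z.2 z.1 :=
    fun ξ => ((continuous_japRatio ε (ξ.2 j)).comp continuous_swap).measurable
  exact lintegral_lintegral_wt_mul_collisionAmp_sq_le Φ (continuous_shiftSnd j) hT ε hm
    (fun ξ z => japRatio_pos _ _ _ _) (wt_collisionLift_shiftSnd ε j)
    (lintegral_kernel_shiftSnd_le hM j)

/-- The squared form of the collapsing estimate, with an explicit constant. -/
lemma lintegral_L2E_Rop_collision_sq_le {T ε : ℝ} {M : ℝ≥0∞} (hT : 0 < T)
    (hM : ∀ x s : ℝ, ∫⁻ z : ℝ × ℝ, ENNReal.ofReal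
      ((1 + ((x - z.1 - z.2) ^ 2 + z.1 ^ 2 - z.2 ^ 2 - s) ^ 2)⁻¹ * (japRatio ε x z.1 z.2)⁻¹) ≤ M)
    (j : Fin k) (φ : SchwartzMap ((Fin (k + 1) → ℝ) × (Fin (k + 1) → ℝ)) ℂ) :
    ∫⁻ τ in Set.Ioc (0 : ℝ) T,
        L2E k (Rop ε k (collision k j (fun y => freeEvol (k + 1) τ φ y))) ^ 2 ≤
      (ENNReal.ofReal (4 * ((2 * Real.pi) ^ 2)⁻¹) *
        (ENNReal.ofReal (2 * Real.exp 1 * (√(Real.pi * T ^ 2) * (1 + 4 / T ^ 2))) * M)) *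
        L2E (k + 1) (Rop ε (k + 1) φ) ^ 2 := by
  have hadd : ∀ {F G : ℝ → ℝ≥0∞} (a b : ℝ≥0∞), Measurable F → Measurable G →
      ∫⁻ τ in Set.Ioc (0 : ℝ) T, a * (b * (F τ + G τ)) =
        a * (b * ((∫⁻ τ in Set.Ioc (0 : ℝ) T, F τ) + ∫⁻ τ in Set.Ioc (0 : ℝ) T, G τ)) := by
    intro F G a b hF hG
    rw [lintegral_const_mul _ (by fun_prop), lintegral_const_mul _ (by fun_prop),
      lintegral_add_left hF]
  refine (lintegral_mono fun τ => L2E_Rop_collision_sq_le ε j τ φ).trans ?_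
  rw [L2E_sq, lintegral_enorm_Rop_schwartz_sq]
  generalize ftSchwartz (k + 1) φ = Φ
  rw [hadd _ _ (measurable_lintegral_wt_mul_collisionAmp_sq ε Φ (continuous_shiftFst j))
    (measurable_lintegral_wt_mul_collisionAmp_sq ε Φ (continuous_shiftSnd j))]
  refine (mul_le_mul_right (mul_le_mul_right (add_le_add
    (lintegral_wt_mul_collisionAmp_shiftFst_sq_le hT hM j Φ)
    (lintegral_wt_mul_collisionAmp_shiftSnd_sq_le hT hM j Φ)) _) _).trans (le_of_eq ?_)
  have hd : ENNReal.ofReal (((2 * Real.pi) ^ (2 * (k + 1)))⁻¹) =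
      ENNReal.ofReal (((2 * Real.pi) ^ (2 * k))⁻¹) * ENNReal.ofReal (((2 * Real.pi) ^ 2)⁻¹) := by
    rw [← ENNReal.ofReal_mul (by positivity), mul_add, pow_add, mul_inv]
  have h2 : ENNReal.ofReal (2 * (((2 * Real.pi) ^ 2)⁻¹) ^ 2) =
      2 * ENNReal.ofReal (((2 * Real.pi) ^ 2)⁻¹) ^ 2 := by
    rw [ENNReal.ofReal_mul (by norm_num), ENNReal.ofReal_pow (by positivity)]
    norm_num
  have h4 : ENNReal.ofReal (4 * ((2 * Real.pi) ^ 2)⁻¹) =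
      4 * ENNReal.ofReal (((2 * Real.pi) ^ 2)⁻¹) := by
    rw [ENNReal.ofReal_mul (by norm_num)]
    norm_num
  rw [hd, h2, h4]
  ring

end Assembly

/-- **Optimal 1D collapsing estimate** (positive part of Theorem 1.3): for every `T > 0` and
`ε > 0` there is a constant `C > 0`, independent of `k`, `j` and `φ`, such that
`(∫_0^T ‖R_ε^{(k)} B_{j,k+1} U^{(k+1)}(τ) φ‖_{L²}² dτ)^{1/2} ≤ C ‖R_ε^{(k+1)} φ‖_{L²}`. -/
theorem optimal_1d_collapsing (T ε : ℝ) (hT : 0 < T) (hε : 0 < ε) :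
    ∃ C : ℝ, 0 < C ∧ ∀ (k : ℕ), 1 ≤ k → ∀ (j : Fin k)
      (φ : SchwartzMap ((Fin (k+1) → ℝ) × (Fin (k+1) → ℝ)) ℂ),
      (∫⁻ τ in Set.Ioc (0 : ℝ) T,
          (L2E k (Rop ε k (collision k j (fun y => freeEvol (k+1) τ (⇑φ) y)))) ^ 2) ^ (1/2 : ℝ)
        ≤ ENNReal.ofReal C * L2E (k+1) (Rop ε (k+1) ⇑φ) := by
  obtain ⟨M, hM_top, hM⟩ := exists_kernel_bound hε
  set A : ℝ≥0∞ := ENNReal.ofReal (4 * ((2 * Real.pi) ^ 2)⁻¹) *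
    (ENNReal.ofReal (2 * Real.exp 1 * (√(Real.pi * T ^ 2) * (1 + 4 / T ^ 2))) * M) with hA
  have hA_top : A ≠ ⊤ := ENNReal.mul_ne_top ENNReal.ofReal_ne_top
    (ENNReal.mul_ne_top ENNReal.ofReal_ne_top hM_top.ne)
  refine ⟨(A ^ (1 / 2 : ℝ)).toReal + 1, by positivity, fun k _ j φ => ?_⟩
  calc _ ≤ (A * L2E (k + 1) (Rop ε (k + 1) φ) ^ 2) ^ (1 / 2 : ℝ) :=
        ENNReal.rpow_le_rpow (lintegral_L2E_Rop_collision_sq_le hT hM j φ) (by norm_num)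
    _ = A ^ (1 / 2 : ℝ) * L2E (k + 1) (Rop ε (k + 1) φ) := by
        rw [ENNReal.mul_rpow_of_nonneg _ _ (by norm_num), ← ENNReal.rpow_two, ← ENNReal.rpow_mul]
        norm_num
    _ ≤ _ := by
        gcongr
        refine ENNReal.le_ofReal_iff_toReal_le ?_ (by positivity) |>.2 (by linarith)
        exact ENNReal.rpow_ne_top_of_nonneg (by norm_num) hA_top

end
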